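/- arXiv:2011.05536 — 2 statements merged into one kernel-verified Lean document; each statement's English description precedes it below -/
import Mathlib

section
/- Let F : A → B be a curved A∞-functor between curved A∞-categories over 𝕂 equipped with ℝ-filtrations F₀ on A and F₁ on B that are bounded above, and suppose F respects the filtrations. If b ∈ F₀^{>0}A¹(X,X) is a Maurer–Cartan element for the object X, then the pushforward F_*b := Σ_{k≥0} F^k(b,…,b) is a finite sum, lies in F₁^{>0}B¹(F(X),F(X)), and is a Maurer–Cartan element for the object F(X), i.e. Σ_{k≥0} m_B^k(F_*b,…,F_*b) = 0. -/
/-!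
Curved A∞-categories over a commutative ring `𝕜`, with a compatible ℝ-filtration,
encoded via the total morphism module `E`.

* `mem x X Y d` means that `x : E` lies in the degree-`d` graded piece of the morphism
  space `A(X, Y)`.
* The higher operations `m^k` (`k ≥ 1`) are encoded by `op`, which takes the composable
  chain of inputs as a list written in composition order,
  `op [x₁, …, x_k] = m^k(x_k, …, x₁)`, and the curvature `m⁰(1) ∈ A(X, X)` is `mu0 X`.
* `filt l` is the filtration level `F^{≥ l}`.
-/

structure FilteredCurvedCat (𝕜 : Type) [CommRing 𝕜] : Type 1 where
  Obj : Type
  E : Type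
  [instAddCommGroup : AddCommGroup E]
  [instModule : Module 𝕜 E]
  mem : E → Obj → Obj → ℤ → Prop
  mem_zero : ∀ X Y d, mem 0 X Y d
  mem_add : ∀ {x y : E} {X Y : Obj} {d : ℤ}, mem x X Y d → mem y X Y d → mem (x + y) X Y d
  mem_smul : ∀ (c : 𝕜) {x : E} {X Y : Obj} {d : ℤ}, mem x X Y d → mem (c • x) X Y d
  mu0 : Obj → E
  mu0_mem : ∀ X, mem (mu0 X) X X 2
  op : List E → E
  op_mem : ∀ (xs : List E) (X : ℕ → Obj) (d : ℕ → ℤ), xs ≠ [] →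
      (∀ i < xs.length, mem (xs.getD i 0) (X i) (X (i + 1)) (d i)) →
      mem (op xs) (X 0) (X xs.length)
        ((∑ i ∈ Finset.range xs.length, d i) + 2 - (xs.length : ℤ))
  op_add : ∀ (ys zs : List E) (x y : E),
      op (ys ++ (x + y) :: zs) = op (ys ++ x :: zs) + op (ys ++ y :: zs)
  op_smul : ∀ (ys zs : List E) (c : 𝕜) (x : E),
      op (ys ++ (c • x) :: zs) = c • op (ys ++ x :: zs)
  filt : ℝ → Set E
  filt_antitone : ∀ {l l' : ℝ}, l ≤ l' → filt l' ⊆ filt l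
  filt_zero : ∀ l : ℝ, (0 : E) ∈ filt l
  filt_add : ∀ {x y : E} {l₁ l₂ : ℝ}, x ∈ filt l₁ → y ∈ filt l₂ → x + y ∈ filt (min l₁ l₂)
  filt_smul : ∀ (c : 𝕜) {x : E} {l : ℝ}, x ∈ filt l → c • x ∈ filt l
  filt_exhaustive : ∀ x : E, ∃ l : ℝ, x ∈ filt l
  filt_op : ∀ (xs : List E) (lam : ℕ → ℝ), xs ≠ [] →
      (∀ i < xs.length, xs.getD i 0 ∈ filt (lam i)) →
      op xs ∈ filt (∑ i ∈ Finset.range xs.length, lam i)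
  filt_mu0 : ∀ X, ∃ l > (0 : ℝ), mu0 X ∈ filt l
  ainfty : ∀ (xs : List E) (X : ℕ → Obj) (d : ℕ → ℤ),
      (∀ i < xs.length, mem (xs.getD i 0) (X i) (X (i + 1)) (d i)) →
      ∑ p ∈ Finset.range (xs.length + 1), ∑ j ∈ Finset.range (xs.length + 1 - p),
        (Int.negOnePow ((∑ t ∈ Finset.range p, d t) - (p : ℤ)) : ℤ) •
          op (xs.take p ++
            (if j = 0 then mu0 (X p) else op ((xs.drop p).take j)) :: xs.drop (p + j)) = 0

attribute [instance] FilteredCurvedCat.instAddCommGroup FilteredCurvedCat.instModule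

namespace FilteredCurvedCat

variable {𝕜 : Type} [CommRing 𝕜] (C : FilteredCurvedCat 𝕜)

/-- `m^k` with the convention that the `0`-ary operation is the curvature at `X`. -/
def opc (X : C.Obj) (xs : List C.E) : C.E := if xs.isEmpty then C.mu0 X else C.op xs

/-- The filtration is bounded above. -/
def FiltBoundedAbove : Prop := ∃ l₀ : ℝ, ∀ l ≥ l₀, ∀ x ∈ C.filt l, x = 0

/-- Insert, for each `i`, `l i` copies of `b i` to the left of the `i`-th entry of the
composable chain `xs` (and `l k` copies of `b k` at the far end, where `k = xs.length`). -/
def expand (xs : List C.E) (b : ℕ → C.E) (l : Fin (xs.length + 1) → ℕ) : List C.E :=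
  ((List.finRange xs.length).flatMap fun i =>
      List.replicate (l i.castSucc) (b i.val) ++ [xs.get i]) ++
    List.replicate (l (Fin.last xs.length)) (b xs.length)

/-- The term `m^{k+l₀+⋯+l_k}(b_k, …, b_k, a_k, …, a_1, b₀, …, b₀)` of the deformed
operation, indexed by the insertion tuple `l = (l₀, …, l_k)`. -/
def deformedTerm (X : C.Obj) (xs : List C.E) (b : ℕ → C.E)
    (l : Fin (xs.length + 1) → ℕ) : C.E :=
  C.opc X (C.expand xs b l)

/-- The deformed operation `m^{k; b_k, …, b₀}(a_k, …, a₁)`. -/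
noncomputable def deformedOp (X : C.Obj) (xs : List C.E) (b : ℕ → C.E) : C.E :=
  ∑ᶠ l : Fin (xs.length + 1) → ℕ, C.deformedTerm X xs b l

/-- `b` is a Maurer–Cartan element for the object `X`: a degree-one element of
`F^{>0} A¹(X, X)` satisfying `∑_{k ≥ 0} m^k(b, …, b) = 0`. -/
def IsMaurerCartan (X : C.Obj) (b : C.E) : Prop :=
  C.mem b X X 1 ∧ (∃ l > (0 : ℝ), b ∈ C.filt l) ∧
    (∑ᶠ n : ℕ, C.opc X (List.replicate n b)) = 0

end FilteredCurvedCat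
/-- The list of inputs `(F^{k_s}(…), …, F^{k₁}(…))` of the target operations appearing in
the curved A∞-functor equation, for the block decomposition `ks = (k₁, …, k_s)` of the
composable chain `xs` (blocks of size `0` contribute the element `F⁰(1)` at the
corresponding object). -/
def functorPieces {𝕜 : Type} [CommRing 𝕜] {C D : FilteredCurvedCat 𝕜}
    (F0 : C.Obj → D.E) (Fop : List C.E → D.E) (X : ℕ → C.Obj) (xs : List C.E)
    (ks : List ℕ) : List D.E :=
  (List.range ks.length).map fun i =>
    if ks.getD i 0 = 0 then F0 (X ((ks.take i).sum))
    else Fop ((xs.drop ((ks.take i).sum)).take (ks.getD i 0))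

/-- A curved A∞-functor between curved A∞-categories.  `F0 X` is the element
`F⁰(1) ∈ B(F(X), F(X))`, and `Fop` encodes the maps `F^k` for `k ≥ 1`, taking the chain of
composable inputs as a list in composition order.  The field `funceq` is the curved
A∞-functor equation. -/
structure CurvedFunctor {𝕜 : Type} [CommRing 𝕜] (C D : FilteredCurvedCat 𝕜) where
  onObj : C.Obj → D.Obj
  F0 : C.Obj → D.E
  F0_mem : ∀ X, D.mem (F0 X) (onObj X) (onObj X) 1
  Fop : List C.E → D.E
  Fop_mem : ∀ (xs : List C.E) (X : ℕ → C.Obj) (d : ℕ → ℤ), xs ≠ [] →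
      (∀ i < xs.length, C.mem (xs.getD i 0) (X i) (X (i + 1)) (d i)) →
      D.mem (Fop xs) (onObj (X 0)) (onObj (X xs.length))
        ((∑ i ∈ Finset.range xs.length, d i) + 1 - (xs.length : ℤ))
  Fop_add : ∀ (ys zs : List C.E) (x y : C.E),
      Fop (ys ++ (x + y) :: zs) = Fop (ys ++ x :: zs) + Fop (ys ++ y :: zs)
  Fop_smul : ∀ (ys zs : List C.E) (c : 𝕜) (x : C.E),
      Fop (ys ++ (c • x) :: zs) = c • Fop (ys ++ x :: zs)
  funceq : ∀ (xs : List C.E) (X : ℕ → C.Obj) (d : ℕ → ℤ),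
      (∀ i < xs.length, C.mem (xs.getD i 0) (X i) (X (i + 1)) (d i)) →
      (∑ᶠ ks : List ℕ, if ks.sum = xs.length then
          D.opc (onObj (X 0)) (functorPieces F0 Fop X xs ks) else 0) =
      ∑ p ∈ Finset.range (xs.length + 1), ∑ j ∈ Finset.range (xs.length + 1 - p),
        (Int.negOnePow ((∑ t ∈ Finset.range p, d t) - (p : ℤ)) : ℤ) •
          Fop (xs.take p ++
            (if j = 0 then C.mu0 (X p) else C.op ((xs.drop p).take j)) :: xs.drop (p + j))

namespace CurvedFunctor

variable {𝕜 : Type} [CommRing 𝕜] {C D : FilteredCurvedCat 𝕜}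

/-- `F^k` with the convention that the `0`-ary term is `F⁰(1)` at the object `X`. -/
def app (F : CurvedFunctor C D) (X : C.Obj) (xs : List C.E) : D.E :=
  if xs.isEmpty then F.F0 X else F.Fop xs

/-- The functor respects the filtrations. -/
def RespectsFilt (F : CurvedFunctor C D) : Prop :=
  (∀ X, ∃ l > (0 : ℝ), F.F0 X ∈ D.filt l) ∧
  ∀ (xs : List C.E) (lam : ℕ → ℝ), xs ≠ [] →
    (∀ i < xs.length, xs.getD i 0 ∈ C.filt (lam i)) →
    F.Fop xs ∈ D.filt (∑ i ∈ Finset.range xs.length, lam i)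

/-- The pushforward `F_* b = ∑_{k ≥ 0} F^k(b, …, b)` of an element `b ∈ A(X, X)`. -/
noncomputable def pushforward (F : CurvedFunctor C D) (X : C.Obj) (b : C.E) : D.E :=
  ∑ᶠ n : ℕ, F.app X (List.replicate n b)

end CurvedFunctor

section Finsum

/-- A finitely supported sum may be computed fibre by fibre along any map. -/
theorem finsum_finsum_ite_fiber {ι κ M : Type*} [DecidableEq κ] [AddCommMonoid M] (f : ι → κ)
    (G : ι → M) (hG : (Function.support G).Finite) :
    ∑ᶠ n : κ, ∑ᶠ i : ι, (if f i = n then G i else 0) = ∑ᶠ i : ι, G i := by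
  have h1 : ∀ n : κ, ∑ᶠ i : ι, (if f i = n then G i else 0) =
      ∑ i ∈ hG.toFinset, if f i = n then G i else 0 := fun n =>
    finsum_eq_sum_of_support_subset _ fun i hi => by
      simp only [Function.mem_support, ne_eq, ite_eq_right_iff, not_forall] at hi
      simpa using hi.2
  simp_rw [h1]
  rw [finsum_sum_comm, finsum_eq_sum_of_support_subset G (s := hG.toFinset) (by simp)]
  · refine Finset.sum_congr rfl fun i _ => ?_
    rw [finsum_eq_single _ (f i) fun n hn => if_neg hn.symm, if_pos rfl]
  · intro i _
    refine (Set.finite_singleton (f i)).subset fun n hn => ?_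
    simp only [Function.mem_support, ne_eq, ite_eq_right_iff, not_forall] at hn
    exact hn.1.symm

theorem finsum_ite_add_add_eq {M : Type*} [AddCommMonoid M] (H : ℕ × ℕ × ℕ → M) (n : ℕ) :
    ∑ᶠ t : ℕ × ℕ × ℕ, (if t.1 + t.2.1 + t.2.2 = n then H t else 0) =
      ∑ p ∈ Finset.range (n + 1), ∑ j ∈ Finset.range (n + 1 - p), H (p, j, n - (p + j)) := by
  rw [finsum_eq_sum_of_support_subset _
    (s := Finset.range (n + 1) ×ˢ Finset.range (n + 1) ×ˢ Finset.range (n + 1))]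
  · simp only [Finset.sum_product]
    refine Finset.sum_congr rfl fun p hp => ?_
    symm
    refine Finset.sum_subset_zero_on_sdiff (fun j hj => ?_) (fun j hj => ?_) fun j hj => ?_
    · simp only [Finset.mem_range] at *; omega
    · simp only [Finset.mem_sdiff, Finset.mem_range] at *
      exact Finset.sum_eq_zero fun q _ => if_neg (by omega)
    · simp only [Finset.mem_range] at *
      rw [Finset.sum_eq_single (n - (p + j)), if_pos (by omega)]
      · intro q _ hq
        exact if_neg (by omega)
      · intro h
        simp only [Finset.mem_range] at h
        omega
  · intro t ht
    simp only [Function.mem_support, ne_eq, ite_eq_right_iff, not_forall] at ht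
    have := ht.1
    simp only [Finset.coe_product, Set.mem_prod, Finset.mem_coe, Finset.mem_range]
    omega

end Finsum

section ListMultilinear

variable {M M' : Type*} [AddCommGroup M] [AddCommGroup M'] {g : List M → M'}

theorem map_append_sum_cons_of_add
    (hg : ∀ (ys zs : List M) (x y : M),
      g (ys ++ (x + y) :: zs) = g (ys ++ x :: zs) + g (ys ++ y :: zs))
    {ι : Type*} (s : Finset ι) (φ : ι → M) (ys zs : List M) :
    g (ys ++ (∑ i ∈ s, φ i) :: zs) = ∑ i ∈ s, g (ys ++ φ i :: zs) :=
  map_sum (AddMonoidHom.mk' (fun x => g (ys ++ x :: zs)) (hg ys zs)) φ s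

theorem map_append_zero_cons_of_add
    (hg : ∀ (ys zs : List M) (x y : M),
      g (ys ++ (x + y) :: zs) = g (ys ++ x :: zs) + g (ys ++ y :: zs))
    (ys zs : List M) : g (ys ++ 0 :: zs) = 0 :=
  map_zero (AddMonoidHom.mk' (fun x => g (ys ++ x :: zs)) (hg ys zs))

theorem map_eq_zero_of_zero_mem
    (hg : ∀ (ys zs : List M) (x y : M),
      g (ys ++ (x + y) :: zs) = g (ys ++ x :: zs) + g (ys ++ y :: zs))
    {xs : List M} (h : (0 : M) ∈ xs) : g xs = 0 := by
  obtain ⟨ys, zs, rfl⟩ := List.append_of_mem h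
  exact map_append_zero_cons_of_add hg ys zs

/-- The words of length `n` in the letters `0, …, N - 1`. -/
def wordsOfLength (N : ℕ) : ℕ → Finset (List ℕ)
  | 0 => {[]}
  | n + 1 => (Finset.range N ×ˢ wordsOfLength N n).image fun p => p.1 :: p.2

theorem mem_wordsOfLength {N n : ℕ} {ks : List ℕ} :
    ks ∈ wordsOfLength N n ↔ ks.length = n ∧ ∀ k ∈ ks, k < N := by
  induction n generalizing ks with
  | zero =>
    simp only [wordsOfLength, Finset.mem_singleton, List.length_eq_zero_iff]
    exact ⟨fun h => ⟨h, by simp [h]⟩, fun h => h.1⟩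
  | succ n ih => cases ks <;> simp [wordsOfLength, ih]; tauto

theorem map_append_replicate_sum_of_add
    (hg : ∀ (ys zs : List M) (x y : M),
      g (ys ++ (x + y) :: zs) = g (ys ++ x :: zs) + g (ys ++ y :: zs))
    (N : ℕ) (φ : ℕ → M) (n : ℕ) (ys : List M) :
    g (ys ++ List.replicate n (∑ k ∈ Finset.range N, φ k)) =
      ∑ ks ∈ wordsOfLength N n, g (ys ++ ks.map φ) := by
  induction n generalizing ys with
  | zero => simp [wordsOfLength]
  | succ n ih =>
    rw [List.replicate_succ, map_append_sum_cons_of_add hg, wordsOfLength,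
      Finset.sum_image (by rintro ⟨a, b⟩ _ ⟨c, d⟩ _ h; simpa using h), Finset.sum_product]
    refine Finset.sum_congr rfl fun k _ => ?_
    simpa using ih (ys ++ [φ k])

end ListMultilinear

namespace FilteredCurvedCat

variable {𝕜 : Type} [CommRing 𝕜] {C : FilteredCurvedCat 𝕜}

theorem opc_of_ne_nil (X : C.Obj) {xs : List C.E} (h : xs ≠ []) : C.opc X xs = C.op xs := by
  simp [opc, h]

theorem opc_eq_zero_of_zero_mem (X : C.Obj) {xs : List C.E} (h : (0 : C.E) ∈ xs) :
    C.opc X xs = 0 := by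
  rw [opc_of_ne_nil X (List.ne_nil_of_mem h), map_eq_zero_of_zero_mem C.op_add h]

theorem op_mem_filt {δ : ℝ} {xs : List C.E} (hne : xs ≠ []) (h : ∀ x ∈ xs, x ∈ C.filt δ) :
    C.op xs ∈ C.filt (xs.length * δ) := by
  have := C.filt_op xs (fun _ => δ) hne fun i hi => by
    rw [List.getD_eq_getElem _ _ hi]; exact h _ (List.getElem_mem hi)
  simpa using this

theorem FiltBoundedAbove.eq_zero_of_large (h : C.FiltBoundedAbove) {δ : ℝ} (hδ : 0 < δ) :
    ∃ N : ℕ, 0 < N ∧ ∀ n ≥ N, ∀ x ∈ C.filt (n * δ), x = 0 := by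
  obtain ⟨l₀, hl₀⟩ := h
  obtain ⟨N, hN⟩ := exists_nat_ge (l₀ / δ)
  refine ⟨N + 1, N.succ_pos, fun n hn x hx => hl₀ _ ?_ x hx⟩
  rw [div_le_iff₀ hδ] at hN
  refine hN.trans (mul_le_mul_of_nonneg_right ?_ hδ.le)
  exact_mod_cast (Nat.le_succ N).trans hn

theorem filt_mul_subset {δ : ℝ} (hδ : 0 < δ) {n : ℕ} (hn : n ≠ 0) :
    C.filt (n * δ) ⊆ C.filt δ :=
  C.filt_antitone (le_mul_of_one_le_left hδ.le (by exact_mod_cast Nat.one_le_iff_ne_zero.2 hn))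

theorem opc_replicate_mem_filt {X : C.Obj} {b : C.E} {δ : ℝ} (hδ : 0 < δ) (hb : b ∈ C.filt δ)
    (hX : C.mu0 X ∈ C.filt δ) (n : ℕ) : C.opc X (List.replicate n b) ∈ C.filt δ := by
  rcases eq_or_ne n 0 with rfl | hn
  · simpa [opc] using hX
  · rw [opc_of_ne_nil X (by simpa using hn)]
    refine filt_mul_subset hδ hn ?_
    simpa using op_mem_filt (xs := List.replicate n b) (by simpa using hn)
      fun x hx => (List.eq_of_mem_replicate hx) ▸ hb

theorem opc_replicate_eq_zero {X : C.Obj} {b : C.E} {δ : ℝ} (hb : b ∈ C.filt δ) {N : ℕ} (hN0 : 0 < N)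
    (hN : ∀ n ≥ N, ∀ x ∈ C.filt (n * δ), x = 0) :
    ∀ n ≥ N, C.opc X (List.replicate n b) = 0 := fun n hn => by
  have hne : List.replicate n b ≠ [] := by simp; omega
  rw [opc_of_ne_nil X hne]
  refine hN n hn _ ?_
  simpa using op_mem_filt hne fun x hx => (List.eq_of_mem_replicate hx) ▸ hb

end FilteredCurvedCat

namespace CurvedFunctor

open FilteredCurvedCat

variable {𝕜 : Type} [CommRing 𝕜] {C D : FilteredCurvedCat 𝕜} {F : CurvedFunctor C D}

theorem app_replicate_mem {X : C.Obj} {b : C.E} (hb : C.mem b X X 1) (n : ℕ) :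
    D.mem (F.app X (List.replicate n b)) (F.onObj X) (F.onObj X) 1 := by
  rcases eq_or_ne n 0 with rfl | hn
  · simpa [app] using F.F0_mem X
  · have := F.Fop_mem (List.replicate n b) (fun _ => X) (fun _ => 1) (by simpa using hn)
      fun i hi => by rw [List.getD_eq_getElem _ _ hi]; simpa using hb
    simpa [app, hn] using this

theorem RespectsFilt.Fop_mem_filt (hF : F.RespectsFilt) {δ : ℝ} {xs : List C.E} (hne : xs ≠ [])
    (h : ∀ x ∈ xs, x ∈ C.filt δ) : F.Fop xs ∈ D.filt (xs.length * δ) := by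
  have := hF.2 xs (fun _ => δ) hne fun i hi => by
    rw [List.getD_eq_getElem _ _ hi]; exact h _ (List.getElem_mem hi)
  simpa using this

theorem RespectsFilt.app_replicate_mem_filt_mul (hF : F.RespectsFilt) {X : C.Obj} {b : C.E} {δ : ℝ}
    (hb : b ∈ C.filt δ) {n : ℕ} (hn : n ≠ 0) :
    F.app X (List.replicate n b) ∈ D.filt (n * δ) := by
  simpa [app, hn] using hF.Fop_mem_filt (xs := List.replicate n b) (by simpa using hn)
    fun x hx => (List.eq_of_mem_replicate hx) ▸ hb

theorem RespectsFilt.app_replicate_mem_filt (hF : F.RespectsFilt) {X : C.Obj} {b : C.E} {δ : ℝ}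
    (hδ : 0 < δ) (hb : b ∈ C.filt δ) (hX : F.F0 X ∈ D.filt δ) (n : ℕ) :
    F.app X (List.replicate n b) ∈ D.filt δ := by
  rcases eq_or_ne n 0 with rfl | hn
  · simpa [app] using hX
  · exact filt_mul_subset hδ hn (hF.app_replicate_mem_filt_mul hb hn)

theorem functorPieces_replicate (X : C.Obj) (b : C.E) (ks : List ℕ) :
    functorPieces F.F0 F.Fop (fun _ => X) (List.replicate ks.sum b) ks =
      ks.map fun k => F.app X (List.replicate k b) := by
  refine List.ext_getElem (by simp [functorPieces]) fun i h₁ h₂ => ?_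
  have hi : i < ks.length := by simpa using h₂
  have hsum : ks[i] ≤ ks.sum - (ks.take i).sum := by
    have h := List.sum_take_add_sum_drop ks i
    rw [List.drop_eq_getElem_cons hi, List.sum_cons] at h
    omega
  simp [functorPieces, app, hi, List.take_replicate, List.drop_replicate, min_eq_left hsum]

/-- The curved `A∞`-functor equation on the constant chain `(b, …, b)`: every sign is `+1`. -/
theorem funceq_replicate {X : C.Obj} {b : C.E} (hb : C.mem b X X 1) (n : ℕ) :
    (∑ᶠ ks : List ℕ, if ks.sum = n then
        D.opc (F.onObj X) (ks.map fun k => F.app X (List.replicate k b)) else 0) =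
      ∑ p ∈ Finset.range (n + 1), ∑ j ∈ Finset.range (n + 1 - p),
        F.Fop (List.replicate p b ++
          C.opc X (List.replicate j b) :: List.replicate (n - (p + j)) b) := by
  have h := F.funceq (List.replicate n b) (fun _ => X) (fun _ => 1)
    fun i hi => by rw [List.getD_eq_getElem _ _ hi]; simpa using hb
  simp only [List.length_replicate] at h
  calc _ = _ := finsum_congr fun ks => by
        by_cases hks : ks.sum = n
        · rw [if_pos hks, if_pos hks, ← functorPieces_replicate, hks]
        · rw [if_neg hks, if_neg hks]
    _ = _ := h
    _ = _ := by
      refine Finset.sum_congr rfl fun p hp => Finset.sum_congr rfl fun j hj => ?_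
      simp only [Finset.mem_range] at hp hj
      have hp' : min p n = p := by omega
      have hj' : min j (n - p) = j := by omega
      simp [List.take_replicate, List.drop_replicate, hp', hj', opc]

/-- The terms `F^{p+1+q}(b, …, b, m^j(b, …, b), b, …, b)` sum to zero when `b` is
Maurer–Cartan, and only finitely many of them are nonzero. -/
theorem RespectsFilt.finsum_Fop_insert_opc (hF : F.RespectsFilt) (hbdC : C.FiltBoundedAbove)
    (hbdD : D.FiltBoundedAbove) {X : C.Obj} {b : C.E} (hb : C.IsMaurerCartan X b)
    (H : ℕ × ℕ × ℕ → D.E) (hH : ∀ p j q, H (p, j, q) = F.Fop (List.replicate p b ++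
      C.opc X (List.replicate j b) :: List.replicate q b)) :
    (Function.support H).Finite ∧ ∑ᶠ t, H t = 0 := by
  obtain ⟨-, ⟨ε, hε, hbε⟩, hsum⟩ := hb
  obtain ⟨ε', hε', hX⟩ := C.filt_mu0 X
  obtain ⟨δ, hδ, hδε, hδε'⟩ : ∃ δ > 0, δ ≤ ε ∧ δ ≤ ε' :=
    ⟨min ε ε', lt_min hε hε', min_le_left _ _, min_le_right _ _⟩
  replace hbδ := C.filt_antitone hδε hbε
  replace hX := C.filt_antitone hδε' hX
  obtain ⟨J, hJ0, hJ⟩ := hbdC.eq_zero_of_large hδ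
  obtain ⟨N, -, hN⟩ := hbdD.eq_zero_of_large hδ
  have hopc := opc_replicate_eq_zero (X := X) hbδ hJ0 hJ
  have hsupp : Function.support H ⊆
      (Finset.range N ×ˢ Finset.range J ×ˢ Finset.range N : Finset (ℕ × ℕ × ℕ)) := by
    rintro ⟨p, j, q⟩ ht
    rw [Function.mem_support, hH] at ht
    have hj : j < J := by
      by_contra! hj
      rw [hopc j hj, map_append_zero_cons_of_add F.Fop_add] at ht
      exact ht rfl
    have hpq : p + (q + 1) < N := by
      by_contra! hpq
      refine ht (hN _ hpq _ ?_)
      have := hF.Fop_mem_filt (δ := δ) (xs := List.replicate p b ++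
        C.opc X (List.replicate j b) :: List.replicate q b) (by simp) fun x hx => by
          simp only [List.mem_append, List.mem_cons, List.mem_replicate] at hx
          rcases hx with ⟨-, rfl⟩ | rfl | ⟨-, rfl⟩
          exacts [hbδ, opc_replicate_mem_filt hδ hbδ hX j, hbδ]
      simpa using this
    simp only [Finset.coe_product, Set.mem_prod, Finset.mem_coe, Finset.mem_range]
    omega
  refine ⟨(Finset.finite_toSet _).subset hsupp, ?_⟩
  rw [finsum_eq_sum_of_support_subset _ (s := Finset.range J) fun n hn => by
    by_contra h
    exact hn (hopc n (by simpa using h))] at hsum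
  rw [finsum_eq_sum_of_support_subset _ hsupp, Finset.sum_product]
  refine Finset.sum_eq_zero fun p _ => ?_
  rw [Finset.sum_product, Finset.sum_comm]
  refine Finset.sum_eq_zero fun q _ => ?_
  simp only [hH]
  rw [← map_append_sum_cons_of_add F.Fop_add, hsum, map_append_zero_cons_of_add F.Fop_add]

end CurvedFunctor

/-- Let `F : A → B` be a curved A∞-functor between curved A∞-categories
over `𝕜` with bounded-above ℝ-filtrations, respecting the filtrations.  If
`b ∈ F₀^{>0} A¹(X, X)` is a Maurer–Cartan element for the object `X`, then the pushforward
`F_* b = ∑_{k ≥ 0} F^k(b, …, b)` is a finite sum, lies in `F₁^{>0} B¹(F(X), F(X))`, and is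
a Maurer–Cartan element for the object `F(X)`, i.e.
`∑_{k ≥ 0} m_B^k(F_* b, …, F_* b) = 0`. -/
theorem pushforward_of_maurer_cartan_is_maurer_cartan
    {𝕜 : Type} [CommRing 𝕜] (C D : FilteredCurvedCat 𝕜)
    (hbdC : C.FiltBoundedAbove) (hbdD : D.FiltBoundedAbove)
    (F : CurvedFunctor C D) (hF : F.RespectsFilt)
    (X : C.Obj) (b : C.E) (hb : C.IsMaurerCartan X b) :
    (Function.support fun n : ℕ => F.app X (List.replicate n b)).Finite ∧
    D.IsMaurerCartan (F.onObj X) (F.pushforward X b) := by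
  obtain ⟨ε, hε, hbε⟩ := hb.2.1
  obtain ⟨ε', hε', hX⟩ := hF.1 X
  obtain ⟨δ, hδ, hδε, hδε'⟩ : ∃ δ > 0, δ ≤ ε ∧ δ ≤ ε' :=
    ⟨min ε ε', lt_min hε hε', min_le_left _ _, min_le_right _ _⟩
  have hbδ := C.filt_antitone hδε hbε
  replace hX := D.filt_antitone hδε' hX
  obtain ⟨N, hN0, hN⟩ := hbdD.eq_zero_of_large hδ
  set φ : ℕ → D.E := fun n => F.app X (List.replicate n b)
  have hφδ : ∀ n, φ n ∈ D.filt δ := hF.app_replicate_mem_filt hδ hbδ hX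
  have hφ0 : ∀ n ≥ N, φ n = 0 := fun n hn =>
    hN n hn _ (hF.app_replicate_mem_filt_mul hbδ (by omega))
  have hsupp : Function.support φ ⊆ (Finset.range N : Finset ℕ) := fun n hn => by
    by_contra h
    exact hn (hφ0 n (by simpa using h))
  have hpush : F.pushforward X b = ∑ n ∈ Finset.range N, φ n :=
    finsum_eq_sum_of_support_subset _ hsupp
  have hpushδ : F.pushforward X b ∈ D.filt δ := by
    rw [hpush]
    exact Finset.sum_induction _ (· ∈ D.filt δ)
      (fun x y hx hy => by simpa using D.filt_add hx hy) (D.filt_zero δ) fun n _ => hφδ n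
  refine ⟨(Finset.finite_toSet _).subset hsupp, ?_, ⟨δ, hδ, hpushδ⟩, ?_⟩
  · rw [hpush]
    exact Finset.sum_induction _ (D.mem · (F.onObj X) (F.onObj X) 1)
      (fun x y => D.mem_add) (D.mem_zero _ _ _) fun n _ => CurvedFunctor.app_replicate_mem hb.1 n
  set G : List ℕ → D.E := fun ks => D.opc (F.onObj X) (ks.map φ) with hG
  have hGlt : ∀ ks, G ks ≠ 0 → ∀ k ∈ ks, k < N := fun ks hks k hk => by
    by_contra! h
    exact hks (FilteredCurvedCat.opc_eq_zero_of_zero_mem _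
      (List.mem_map.2 ⟨k, hk, hφ0 k h⟩))
  have hGlen : ∀ ks, G ks ≠ 0 → ks.length < N := fun ks hks => by
    by_contra! h
    have hne : ks.map φ ≠ [] := by
      rw [← List.length_pos_iff, List.length_map]; omega
    refine hks (hN _ h _ ?_)
    simp only [hG, FilteredCurvedCat.opc_of_ne_nil _ hne]
    simpa using FilteredCurvedCat.op_mem_filt (δ := δ) hne fun x hx => by
      obtain ⟨k, -, rfl⟩ := List.mem_map.1 hx
      exact hφδ k
  have hGfin : (Function.support G).Finite :=
    ((Finset.range N).biUnion (wordsOfLength N)).finite_toSet.subset fun ks hks =>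
      Finset.mem_biUnion.2 ⟨ks.length, Finset.mem_range.2 (hGlen ks hks),
        mem_wordsOfLength.2 ⟨rfl, hGlt ks hks⟩⟩
  have hwords : ∀ n, D.opc (F.onObj X) (List.replicate n (F.pushforward X b)) =
      ∑ᶠ ks : List ℕ, if ks.length = n then G ks else 0 := fun n => by
    rw [finsum_eq_sum_of_support_subset _ (s := wordsOfLength N n) fun ks hks => by
      simp only [Function.mem_support, ne_eq, ite_eq_right_iff, not_forall] at hks
      exact mem_wordsOfLength.2 ⟨hks.1, hGlt ks hks.2⟩]
    rw [Finset.sum_congr rfl fun ks hks => if_pos (mem_wordsOfLength.1 hks).1]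
    rcases eq_or_ne n 0 with rfl | hn
    · simp [wordsOfLength, hG]
    · rw [FilteredCurvedCat.opc_of_ne_nil _ (by simpa using hn), hpush]
      refine (map_append_replicate_sum_of_add D.op_add N φ n []).trans ?_
      refine Finset.sum_congr rfl fun ks hks => ?_
      have hne : ks.map φ ≠ [] := by
        rw [← List.length_pos_iff, List.length_map, (mem_wordsOfLength.1 hks).1]; omega
      simp only [hG, FilteredCurvedCat.opc_of_ne_nil _ hne, List.nil_append]
  let H : ℕ × ℕ × ℕ → D.E := fun t => F.Fop (List.replicate t.1 b ++
    C.opc X (List.replicate t.2.1 b) :: List.replicate t.2.2 b)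
  obtain ⟨hHfin, hH⟩ := hF.finsum_Fop_insert_opc hbdC hbdD hb H fun _ _ _ => rfl
  rw [finsum_congr hwords, finsum_finsum_ite_fiber _ G hGfin,
    ← finsum_finsum_ite_fiber List.sum G hGfin,
    finsum_congr (CurvedFunctor.funceq_replicate hb.1), ← hH,
    ← finsum_finsum_ite_fiber (fun t : ℕ × ℕ × ℕ => t.1 + t.2.1 + t.2.2) H hHfin]
  exact finsum_congr fun n => (finsum_ite_add_add_eq H n).symm
end

section
/- Let F : A → B be a curved A∞-functor between curved A∞-categories over 𝕂 with bounded-above ℝ-filtrations, respecting the filtrations, and let B' be an unobstructed deformation of A; let F_*B' denote the pushforward deformation of B, consisting of the Maurer–Cartan elements F_*b for b ∈ B'. For objects (X₀,b₀),…,(X_k,b_k) of A(B') and k ≥ 1 define F^{k;b₀,…,b_k}(x_k,…,x₁) := Σ_{l₀,…,l_k ≥ 0} F^{k+l₀+⋯+l_k}(b_k,…,b_k, x_k, b_{k−1},…,b_{k−1}, …, x₁, b₀,…,b₀), and note that the zeroth term F^{0;b}(1) = Σ_{m≥0} F^m(b,…,b) − F_*b equals 0. Then these maps satisfy the (uncurved)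 A∞-functor equations with respect to the deformed structure maps, i.e. they define an A∞-functor F_{B'} : A(B') → B(F_*B') between ordinary A∞-categories, which on objects sends (X,b) to (F(X), F_*b). -/
/-- The deformed component `F^{k; b₀, …, b_k}(x_k, …, x₁)
 = ∑_{l₀, …, l_k ≥ 0} F^{k+l₀+⋯+l_k}(b_k, …, b_k, x_k, …, x₁, b₀, …, b₀)` of a curved
A∞-functor, applied to the composable chain `xs` starting at `X` with insertion elements
`b`. -/
noncomputable def CurvedFunctor.deformed {𝕜 : Type} [CommRing 𝕜]
    {C D : FilteredCurvedCat 𝕜} (F : CurvedFunctor C D)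
    (X : C.Obj) (xs : List C.E) (b : ℕ → C.E) : D.E :=
  ∑ᶠ l : Fin (xs.length + 1) → ℕ, F.app X (C.expand xs b l)

/-- Summation along the fibres of `g`. -/
theorem finsum_mem_fiberwise {α β M : Type*} [AddCommMonoid M] {s : Set α} {t : Set β}
    {g : α → β} {f : α → M} (hg : Set.MapsTo g s t)
    (hf : (s ∩ Function.support f).Finite) :
    ∑ᶠ a ∈ s, f a = ∑ᶠ y ∈ t, ∑ᶠ a ∈ s ∩ g ⁻¹' {y}, f a := by
  classical
  have inner (y : β) : ∑ᶠ a ∈ s ∩ g ⁻¹' {y}, f a = ∑ a ∈ hf.toFinset with g a = y, f a := by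
    apply finsum_mem_eq_sum_of_inter_support_eq
    ext a
    simp
    tauto
  rw [finsum_mem_eq_sum_of_inter_support_eq (t := hf.toFinset) f (by simp)]
  simp_rw [inner]
  rw [finsum_mem_eq_sum_of_subset (t := hf.toFinset.image g)]
  · exact (Finset.sum_fiberwise_of_maps_to (fun a ha => Finset.mem_image_of_mem g ha) f).symm
  · rintro y ⟨-, hy⟩
    obtain ⟨a, ha, -⟩ := Finset.exists_ne_zero_of_sum_ne_zero hy
    rw [Finset.mem_filter] at ha
    exact Finset.mem_coe.2 (Finset.mem_image.2 ⟨a, ha⟩)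
  · intro y hy
    obtain ⟨a, ha, rfl⟩ := Finset.mem_image.1 (Finset.mem_coe.1 hy)
    exact hg ((hf.mem_toFinset.1 ha).1)

/-- Lists of bounded length with entries in a finite set form a finite set. -/
theorem List.finite_length_le_of_forall_mem {α : Type*} {s : Set α} (hs : s.Finite) (n : ℕ) :
    {l : List α | l.length ≤ n ∧ ∀ a ∈ l, a ∈ s}.Finite := by
  have := hs.to_subtype
  refine ((List.finite_length_le s n).image (List.map Subtype.val)).subset ?_
  rintro l ⟨hl, h⟩
  exact ⟨l.attach.map fun a => ⟨a.1, h _ a.2⟩, by simpa using hl, by simp⟩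

/-- The word spelled by a path `w` starting at position `s`: a letter `false` stays at the current
position `i` and contributes `b i`, a letter `true` moves from `i` to `i + 1` and contributes
`x i`. -/
def insertionWord {α : Type*} (x b : ℕ → α) : ℕ → List Bool → List α
  | _, [] => []
  | s, false :: w => b s :: insertionWord x b s w
  | s, true :: w => x s :: insertionWord x b (s + 1) w

section insertionWord

variable {α : Type*} (x b : ℕ → α)

@[simp] theorem insertionWord_nil (s : ℕ) : insertionWord x b s [] = [] := rfl

@[simp] theorem insertionWord_false (s : ℕ) (w : List Bool) :
    insertionWord x b s (false :: w) = b s :: insertionWord x b s w := rfl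

@[simp] theorem insertionWord_true (s : ℕ) (w : List Bool) :
    insertionWord x b s (true :: w) = x s :: insertionWord x b (s + 1) w := rfl

@[simp] theorem length_insertionWord (s : ℕ) (w : List Bool) :
    (insertionWord x b s w).length = w.length := by
  induction w generalizing s with
  | nil => rfl
  | cons a w ih => cases a <;> simp [ih]

theorem isEmpty_insertionWord (s : ℕ) (w : List Bool) :
    (insertionWord x b s w).isEmpty = w.isEmpty := by
  cases w with
  | nil => rfl
  | cons a w => cases a <;> rfl

theorem insertionWord_append (s : ℕ) (v w : List Bool) :
    insertionWord x b s (v ++ w) =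
      insertionWord x b s v ++ insertionWord x b (s + v.count true) w := by
  induction v generalizing s with
  | nil => simp
  | cons a v ih =>
    cases a
    · simp [ih]
    · simp [ih, ← add_assoc, add_right_comm s 1]

theorem insertionWord_replicate_false (s n : ℕ) :
    insertionWord x b s (List.replicate n false) = List.replicate n (b s) := by
  induction n with
  | zero => rfl
  | succ n ih => simp [List.replicate_succ, ih]

variable {x b} in
theorem insertionWord_congr {x' b' : ℕ → α} {w : List Bool} {s s' : ℕ}
    (hx : ∀ t < w.count true, x (s + t) = x' (s' + t))
    (hb : ∀ t ≤ w.count true, b (s + t) = b' (s' + t)) :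
    insertionWord x b s w = insertionWord x' b' s' w := by
  induction w generalizing s s' with
  | nil => rfl
  | cons a w ih =>
    cases a
    · simp only [insertionWord_false]
      rw [ih (by simpa using hx) (by simpa using hb)]
      simpa using hb 0 (Nat.zero_le _)
    · simp only [insertionWord_true]
      simp only [List.count_cons_self] at hx hb
      rw [ih (s' := s' + 1)
        (fun t ht => by simpa [add_assoc, add_comm 1] using hx (t + 1) (by omega))
        (fun t ht => by simpa [add_assoc, add_comm 1] using hb (t + 1) (by omega))]
      simpa using hx 0 (Nat.succ_pos _)

theorem getD_insertionWord (z : α) {s : ℕ} {w : List Bool} {i : ℕ} (hi : i < w.length) :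
    (insertionWord x b s w).getD i z =
      if w.getD i false then x (s + (w.take i).count true)
      else b (s + (w.take i).count true) := by
  induction w generalizing s i with
  | nil => simp at hi
  | cons a w ih =>
    cases i with
    | zero => cases a <;> simp
    | succ i =>
      replace hi : i < w.length := by simpa using hi
      cases a
      · simpa using ih hi
      · simpa [← add_assoc, add_right_comm s 1] using ih (s := s + 1) hi

end insertionWord

/-- The path whose `i`-th step is preceded by `l i` stationary letters. -/
def insertionPath (n : ℕ) (l : Fin (n + 1) → ℕ) : List Bool :=
  ((List.finRange n).flatMap fun i => List.replicate (l i.castSucc) false ++ [true]) ++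
    List.replicate (l (Fin.last n)) false

theorem insertionPath_succ (n : ℕ) (l : Fin (n + 2) → ℕ) :
    insertionPath (n + 1) l =
      List.replicate (l 0) false ++ true :: insertionPath n (fun i => l i.succ) := by
  simp [insertionPath, List.finRange_succ, List.flatMap_map]

theorem expand_eq_insertionWord {𝕜 : Type} [CommRing 𝕜] (C : FilteredCurvedCat 𝕜)
    (xs : List C.E) (b : ℕ → C.E) (l : Fin (xs.length + 1) → ℕ) :
    C.expand xs b l =
      insertionWord (fun t => xs.getD t 0) b 0 (insertionPath xs.length l) := by
  induction xs generalizing b with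
  | nil => simp [FilteredCurvedCat.expand, insertionPath, insertionWord_replicate_false]
  | cons y ys ih =>
    have h : C.expand (y :: ys) b l = List.replicate (l 0) (b 0) ++
        y :: C.expand ys (fun t => b (t + 1)) (fun i => l i.succ) := by
      simp only [FilteredCurvedCat.expand, List.length_cons, List.finRange_succ,
        List.flatMap_cons, List.flatMap_map]
      simp
    rw [h, ih]
    simp only [List.length_cons]
    rw [insertionPath_succ, insertionWord_append, insertionWord_replicate_false]
    simp only [insertionWord_true, List.count_replicate]
    congr 2
    exact insertionWord_congr (by simp [add_comm]) (by simp [add_comm])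

theorem replicate_false_append_inj {m n : ℕ} {v w : List Bool}
    (h : List.replicate m false ++ true :: v = List.replicate n false ++ true :: w) :
    m = n ∧ v = w := by
  induction m generalizing n with
  | zero => cases n <;> simp_all [List.replicate_succ]
  | succ m ih =>
    cases n with
    | zero => simp [List.replicate_succ] at h
    | succ n =>
      simp only [List.replicate_succ, List.cons_append, List.cons.injEq, true_and] at h
      simpa using ih h

theorem exists_eq_replicate_false_append {n : ℕ} {w : List Bool} (h : w.count true = n + 1) :
    ∃ m v, w = List.replicate m false ++ true :: v ∧ v.count true = n := by
  induction w with
  | nil => simp at h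
  | cons a w ih =>
    cases a
    · obtain ⟨m, v, rfl, hv⟩ := ih (by simpa using h)
      exact ⟨m + 1, v, by simp [List.replicate_succ], hv⟩
    · exact ⟨0, w, by simp, by simpa using h⟩

theorem eq_replicate_false {w : List Bool} (h : w.count true = 0) :
    w = List.replicate w.length false := by
  rw [List.count_eq_zero] at h
  rw [List.eq_replicate_iff]
  exact ⟨rfl, fun a ha => by cases a <;> simp_all⟩

theorem bijOn_insertionPath (n : ℕ) :
    Set.BijOn (insertionPath n) Set.univ {w | w.count true = n} := by
  induction n with
  | zero =>
    refine ⟨fun l _ => by simp [insertionPath, List.count_replicate], fun l _ l' _ h => ?_, fun w hw => ?_⟩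
    · have := congrArg List.length h
      ext i
      obtain rfl : i = 0 := by omega
      simpa [insertionPath] using this
    · exact ⟨fun _ => w.length, trivial, by
        simpa [insertionPath] using (eq_replicate_false hw).symm⟩
  | succ n ih =>
    refine ⟨fun l _ => ?_, fun l _ l' _ h => ?_, fun w hw => ?_⟩
    · have := ih.mapsTo (Set.mem_univ fun i => l i.succ)
      simp only [Set.mem_ofPred_eq] at this
      simp [insertionPath_succ, this, List.count_replicate]
    · rw [insertionPath_succ, insertionPath_succ] at h
      obtain ⟨h0, h⟩ := replicate_false_append_inj h
      have := ih.injOn (Set.mem_univ _) (Set.mem_univ _) h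
      ext i
      exact Fin.cases h0 (fun i => congrFun this i) i
    · obtain ⟨m, v, rfl, hv⟩ := exists_eq_replicate_false_append hw
      obtain ⟨l, -, rfl⟩ := ih.surjOn hv
      exact ⟨Fin.cons m l, trivial, by simp [insertionPath_succ]⟩

/-- A sum over insertion tuples is a sum over paths. -/
theorem finsum_expand {𝕜 : Type} [CommRing 𝕜] (C : FilteredCurvedCat 𝕜) {M : Type*}
    [AddCommMonoid M] (f : List C.E → M) (xs : List C.E) (b : ℕ → C.E) :
    ∑ᶠ l : Fin (xs.length + 1) → ℕ, f (C.expand xs b l) =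
      ∑ᶠ w ∈ {w : List Bool | w.count true = xs.length},
        f (insertionWord (fun t => xs.getD t 0) b 0 w) := by
  rw [← finsum_mem_univ]
  exact finsum_mem_eq_of_bijOn _ (bijOn_insertionPath _) fun l _ => by
    rw [expand_eq_insertionWord]

theorem finsum_replicate {α M : Type*} [AddCommMonoid M] (f : List α → M) (x b : ℕ → α) (s : ℕ) :
    ∑ᶠ n : ℕ, f (List.replicate n (b s)) =
      ∑ᶠ w ∈ {w : List Bool | w.count true = 0}, f (insertionWord x b s w) := by
  rw [← finsum_mem_univ]
  refine finsum_mem_eq_of_bijOn (fun n => List.replicate n false) ⟨?_, ?_, ?_⟩ ?_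
  · intro n _
    simp [List.count_replicate]
  · intro m _ n _ h
    simpa using congrArg List.length h
  · intro w hw
    exact ⟨w.length, trivial, (eq_replicate_false hw).symm⟩
  · intro n _
    rw [insertionWord_replicate_false]

theorem sum_range_getD {M : Type*} [AddCommMonoid M] (l : List M) :
    ∑ i ∈ Finset.range l.length, l.getD i 0 = l.sum := by
  induction l with
  | nil => rfl
  | cons a l ih => simp [Finset.sum_range_succ', ← ih, add_comm]

/-- A filtration estimate for an operation on lists, in terms of a list of levels. -/
theorem mem_filt_of_forall₂ {E E' : Type} [Zero E] {P : ℝ → Set E} {Q : ℝ → Set E'}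
    {op : List E → E'}
    (hop : ∀ (xs : List E) (lam : ℕ → ℝ), xs ≠ [] →
      (∀ i < xs.length, xs.getD i 0 ∈ P (lam i)) →
      op xs ∈ Q (∑ i ∈ Finset.range xs.length, lam i))
    {xs : List E} {ls : List ℝ} (hxs : xs ≠ [])
    (h : List.Forall₂ (fun x l => x ∈ P l) xs ls) : op xs ∈ Q ls.sum := by
  rw [← sum_range_getD, ← h.length_eq]
  refine hop xs _ hxs fun i hi => ?_
  have hi' : i < ls.length := h.length_eq ▸ hi
  rw [List.getD_eq_getElem _ _ hi, List.getD_eq_getElem _ _ hi']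
  exact h.get hi hi'

theorem forall₂_insertionWord {E : Type} {P : ℝ → Set E} {x b : ℕ → E} {K : ℕ} {Λ ε : ℝ}
    (hx : ∀ t, x t ∈ P Λ) (hb : ∀ t ≤ K, b t ∈ P ε) {s : ℕ} {w : List Bool}
    (hw : s + w.count true ≤ K) :
    List.Forall₂ (fun x l => x ∈ P l) (insertionWord x b s w)
      (w.map fun a => bif a then Λ else ε) := by
  induction w generalizing s with
  | nil => simp
  | cons a w ih =>
    cases a
    · exact .cons (hb s (by omega)) (ih (by simpa using hw))
    · rw [List.count_cons_self] at hw
      exact .cons (hx s) (ih (by omega))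

theorem sum_map_cond (w : List Bool) (Λ ε : ℝ) :
    (w.map fun a => bif a then Λ else ε).sum = w.count true * Λ + w.count false * ε := by
  induction w with
  | nil => simp
  | cons a w ih => cases a <;> simp [ih] <;> ring

theorem finite_paths (k N : ℕ) :
    {w : List Bool | w.count true = k ∧ w.count false < N}.Finite := by
  refine (List.finite_length_le Bool (k + N)).subset fun w hw => ?_
  have := List.count_false_add_count_true w
  have h1 := hw.1
  have h2 := hw.2
  simp only [Set.mem_ofPred_eq]
  omega

theorem FilteredCurvedCat.FiltBoundedAbove.exists_nat {𝕜 : Type} [CommRing 𝕜]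
    {C : FilteredCurvedCat 𝕜} (hC : C.FiltBoundedAbove) (c : ℝ) {ε : ℝ} (hε : 0 < ε) :
    ∃ N : ℕ, 0 < N ∧ ∀ n ≥ N, ∀ x ∈ C.filt (c + n * ε), x = 0 := by
  obtain ⟨l, hl⟩ := hC
  obtain ⟨N, hN⟩ := exists_nat_gt ((l - c) / ε)
  refine ⟨N + 1, N.succ_pos, fun n hn => hl _ ?_⟩
  rw [div_lt_iff₀ hε] at hN
  have : (N : ℝ) * ε ≤ n * ε := by
    have : (N : ℝ) ≤ n := by exact_mod_cast (by omega : N ≤ n)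
    gcongr
  linarith

theorem FilteredCurvedCat.exists_forall₂_filt {𝕜 : Type} [CommRing 𝕜]
    (C : FilteredCurvedCat 𝕜) (xs : List C.E) :
    ∃ ls : List ℝ, List.Forall₂ (fun x l => x ∈ C.filt l) xs ls := by
  induction xs with
  | nil => exact ⟨[], .nil⟩
  | cons x xs ih =>
    obtain ⟨ls, h⟩ := ih
    obtain ⟨l, hl⟩ := C.filt_exhaustive x
    exact ⟨l :: ls, .cons hl h⟩

/-- The number of stationary letters of a path, where the empty path counts as one. -/
def stationaryWeight (w : List Bool) : ℕ := w.count false + if w = [] then 1 else 0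

/-- The chain of values of a curved functor on the words spelled by successive paths. -/
def CurvedFunctor.pathChain {𝕜 : Type} [CommRing 𝕜] {C D : FilteredCurvedCat 𝕜}
    (F : CurvedFunctor C D) (X : ℕ → C.Obj) (x b : ℕ → C.E) : ℕ → List (List Bool) → List D.E
  | _, [] => []
  | s, w :: L =>
    F.app (X s) (insertionWord x b s w) :: F.pathChain X x b (s + w.count true) L

section finiteness

variable {𝕜 : Type} [CommRing 𝕜] {C D : FilteredCurvedCat 𝕜} {F : CurvedFunctor C D}
  {X : ℕ → C.Obj} {x b : ℕ → C.E} {K : ℕ} {Λ ε : ℝ}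

theorem CurvedFunctor.RespectsFilt.app_mem (hF : F.RespectsFilt)
    (hx : ∀ t, x t ∈ C.filt Λ) (hb : ∀ t ≤ K, b t ∈ C.filt ε)
    (hF0 : ∀ t ≤ K, F.F0 (X t) ∈ D.filt ε) {s : ℕ} {w : List Bool}
    (hw : s + w.count true ≤ K) :
    F.app (X s) (insertionWord x b s w) ∈
      D.filt (w.count true * Λ + stationaryWeight w * ε) := by
  by_cases h : w = []
  · subst h
    simpa [CurvedFunctor.app, stationaryWeight] using hF0 s (by omega)
  · have h' : insertionWord x b s w ≠ [] := by
      rwa [← List.length_pos_iff, length_insertionWord, List.length_pos_iff]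
    have := mem_filt_of_forall₂ hF.2 h' (forall₂_insertionWord hx hb hw)
    rw [sum_map_cond] at this
    simpa [CurvedFunctor.app, stationaryWeight, h, h'] using this

theorem CurvedFunctor.RespectsFilt.finite_app (hF : F.RespectsFilt) (hD : D.FiltBoundedAbove)
    (hε : 0 < ε) (hx : ∀ t, x t ∈ C.filt Λ) (hb : ∀ t ≤ K, b t ∈ C.filt ε)
    (hF0 : ∀ t ≤ K, F.F0 (X t) ∈ D.filt ε) {s k : ℕ} (hk : s + k ≤ K) :
    ({w | w.count true = k} ∩
      Function.support fun w => F.app (X s) (insertionWord x b s w)).Finite := by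
  obtain ⟨N, -, hN⟩ := hD.exists_nat (k * Λ) hε
  refine (finite_paths k N).subset ?_
  rintro w ⟨rfl, hw⟩
  refine ⟨rfl, lt_of_not_ge fun h => hw (hN _ ?_ _ (hF.app_mem hx hb hF0 hk))⟩
  exact h.trans (Nat.le_add_right _ _)

theorem CurvedFunctor.RespectsFilt.forall₂_pathChain (hF : F.RespectsFilt)
    (hx : ∀ t, x t ∈ C.filt Λ) (hb : ∀ t ≤ K, b t ∈ C.filt ε)
    (hF0 : ∀ t ≤ K, F.F0 (X t) ∈ D.filt ε) {s : ℕ} {L : List (List Bool)}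
    (hL : s + L.flatten.count true ≤ K) :
    List.Forall₂ (fun x l => x ∈ D.filt l) (F.pathChain X x b s L)
      (L.map fun w => w.count true * Λ + stationaryWeight w * ε) := by
  induction L generalizing s with
  | nil => exact .nil
  | cons w L ih =>
    rw [List.flatten_cons, List.count_append] at hL
    exact .cons (hF.app_mem hx hb hF0 (by omega)) (ih (by omega))

theorem sum_map_level (L : List (List Bool)) (Λ ε : ℝ) :
    (L.map fun w => w.count true * Λ + stationaryWeight w * ε).sum =
      L.flatten.count true * Λ + (L.map stationaryWeight).sum * ε := by
  induction L with
  | nil => simp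
  | cons w L ih =>
    simp only [List.map_cons, List.sum_cons, ih, List.flatten_cons, List.count_append]
    push_cast
    ring

theorem finite_pathLists (k N : ℕ) :
    {L : List (List Bool) |
      L.flatten.count true = k ∧ (L.map stationaryWeight).sum < N}.Finite := by
  refine (List.finite_length_le_of_forall_mem (List.finite_length_le Bool (k + N))
    (k + N)).subset ?_
  rintro L ⟨h1, h2⟩
  have h3 : L.length ≤ L.flatten.count true + (L.map stationaryWeight).sum ∧
      ∀ w ∈ L, w.length ≤ L.flatten.count true + (L.map stationaryWeight).sum := by
    clear h1 h2
    induction L with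
    | nil => simp
    | cons w L ih =>
      have h4 := List.count_false_add_count_true w
      have h5 : w.count false ≤ stationaryWeight w := Nat.le_add_right _ _
      have h6 : 1 ≤ w.count true + stationaryWeight w := by
        by_cases h : w = []
        · simp [h, stationaryWeight]
        · have := List.length_pos_iff.2 h
          omega
      simp only [List.flatten_cons, List.count_append, List.map_cons, List.sum_cons,
        List.length_cons, List.mem_cons, forall_eq_or_imp]
      exact ⟨by omega, by omega, fun v hv => by have := ih.2 v hv; omega⟩
  exact ⟨by omega, fun w hw => by have := h3.2 w hw; simp only [Set.mem_ofPred_eq]; omega⟩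

theorem CurvedFunctor.pathChain_eq_nil {s : ℕ} {L : List (List Bool)} :
    F.pathChain X x b s L = [] ↔ L = [] := by
  cases L <;> simp [CurvedFunctor.pathChain]

theorem CurvedFunctor.RespectsFilt.finite_pathChain (hF : F.RespectsFilt)
    (hD : D.FiltBoundedAbove)
    (hε : 0 < ε) (hx : ∀ t, x t ∈ C.filt Λ) (hb : ∀ t ≤ K, b t ∈ C.filt ε)
    (hF0 : ∀ t ≤ K, F.F0 (X t) ∈ D.filt ε) (Y : D.Obj) (pre : List D.E) {s k : ℕ}
    (hk : s + k ≤ K) :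
    ({L | L.flatten.count true = k} ∩
      Function.support fun L => D.opc Y (pre ++ F.pathChain X x b s L)).Finite := by
  obtain ⟨ls, hls⟩ := D.exists_forall₂_filt pre
  obtain ⟨N, hN0, hN⟩ := hD.exists_nat (ls.sum + k * Λ) hε
  refine (finite_pathLists k N).subset ?_
  rintro L ⟨rfl, hL⟩
  refine ⟨rfl, lt_of_not_ge fun h => hL (hN _ h _ ?_)⟩
  have hne : pre ++ F.pathChain X x b s L ≠ [] := by
    intro h'
    rw [List.append_eq_nil_iff, CurvedFunctor.pathChain_eq_nil] at h'
    simp [h'.2] at h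
    omega
  have := mem_filt_of_forall₂ D.filt_op hne
    (List.rel_append hls (hF.forall₂_pathChain hx hb hF0 hk))
  rw [List.sum_append, sum_map_level, ← add_assoc] at this
  simpa [FilteredCurvedCat.opc, hne] using this

theorem FilteredCurvedCat.opc_mem (hmu : ∀ t ≤ K, C.mu0 (X t) ∈ C.filt 0)
    (hx : ∀ t, x t ∈ C.filt Λ) (hb : ∀ t ≤ K, b t ∈ C.filt ε) {s : ℕ} {w : List Bool}
    (hw : s + w.count true ≤ K) :
    C.opc (X s) (insertionWord x b s w) ∈
      C.filt (w.count true * Λ + w.count false * ε) := by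
  by_cases h : w = []
  · subst h
    simpa [FilteredCurvedCat.opc] using hmu s (by omega)
  · have h' : insertionWord x b s w ≠ [] := by
      rwa [← List.length_pos_iff, length_insertionWord, List.length_pos_iff]
    have := mem_filt_of_forall₂ C.filt_op h' (forall₂_insertionWord hx hb hw)
    rw [sum_map_cond] at this
    simpa [FilteredCurvedCat.opc, h'] using this

theorem FilteredCurvedCat.finite_opc (hC : C.FiltBoundedAbove) (hε : 0 < ε)
    (hmu : ∀ t ≤ K, C.mu0 (X t) ∈ C.filt 0)
    (hx : ∀ t, x t ∈ C.filt Λ) (hb : ∀ t ≤ K, b t ∈ C.filt ε) {s k : ℕ} (hk : s + k ≤ K) :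
    ({w | w.count true = k} ∩
      Function.support fun w => C.opc (X s) (insertionWord x b s w)).Finite := by
  obtain ⟨N, -, hN⟩ := hC.exists_nat (k * Λ) hε
  refine (finite_paths k N).subset ?_
  rintro w ⟨rfl, hw⟩
  exact ⟨rfl, lt_of_not_ge fun h => hw (hN _ h _ (opc_mem hmu hx hb hk))⟩

/-- The value `F(v, m(w), u)` associated with a factorization of a path into three subpaths. -/
def CurvedFunctor.innerOp (F : CurvedFunctor C D) (X : ℕ → C.Obj) (x b : ℕ → C.E)
    (q : List Bool × List Bool × List Bool) : D.E :=
  F.Fop (insertionWord x b 0 q.1 ++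
    C.opc (X (q.1.count true)) (insertionWord x b (q.1.count true) q.2.1) ::
      insertionWord x b (q.1.count true + q.2.1.count true) q.2.2)

theorem CurvedFunctor.RespectsFilt.finite_innerOp (hF : F.RespectsFilt)
    (hD : D.FiltBoundedAbove) (hε : 0 < ε)
    (hmu : ∀ t ≤ K, C.mu0 (X t) ∈ C.filt 0)
    (hx : ∀ t, x t ∈ C.filt Λ) (hb : ∀ t ≤ K, b t ∈ C.filt ε) :
    ({q | q.1.count true + q.2.1.count true + q.2.2.count true = K} ∩
      Function.support (F.innerOp X x b)).Finite := by
  obtain ⟨N, -, hN⟩ := hD.exists_nat (K * Λ) hε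
  have hfin := List.finite_length_le Bool (K + N)
  refine (hfin.prod (hfin.prod hfin)).subset ?_
  rintro ⟨u, v, w⟩ ⟨hK, hne⟩
  simp only [Set.mem_ofPred_eq] at hK
  have hlt : u.count false + v.count false + w.count false < N := by
    refine lt_of_not_ge fun h => hne (hN _ h _ ?_)
    have := mem_filt_of_forall₂ hF.2 (by simp)
      (List.rel_append (forall₂_insertionWord (s := 0) (w := u) hx hb (by omega))
        (.cons (FilteredCurvedCat.opc_mem (s := u.count true) (w := v) hmu hx hb (by omega))
          (forall₂_insertionWord (s := u.count true + v.count true) (w := w) hx hb (by omega))))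
    rw [List.sum_append, List.sum_cons, sum_map_cond, sum_map_cond] at this
    change F.innerOp X x b (u, v, w) ∈ _ at this
    convert this using 2
    rw [← hK]
    push_cast
    ring
  have h1 := List.count_false_add_count_true u
  have h2 := List.count_false_add_count_true v
  have h3 := List.count_false_add_count_true w
  simp only [Set.mem_prod, Set.mem_ofPred_eq]
  omega

end finiteness

theorem take_insertionWord {α : Type*} (x b : ℕ → α) (s p : ℕ) (w : List Bool) :
    (insertionWord x b s w).take p = insertionWord x b s (w.take p) := by
  induction w generalizing s p with
  | nil => simp
  | cons a w ih => cases p <;> cases a <;> simp [ih]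

theorem drop_insertionWord {α : Type*} (x b : ℕ → α) (s p : ℕ) (w : List Bool) :
    (insertionWord x b s w).drop p =
      insertionWord x b (s + (w.take p).count true) (w.drop p) := by
  induction w generalizing s p with
  | nil => simp
  | cons a w ih =>
    cases p
    · simp
    · cases a
      · simp [ih]
      · simp [ih, ← add_assoc, add_right_comm s 1]

theorem bijOn_map_length {α : Type*} (w : List α) :
    Set.BijOn (List.map List.length) {L : List (List α) | L.flatten = w}
      {ks : List ℕ | ks.sum = w.length} := by
  refine ⟨?_, ?_, ?_⟩
  · rintro L rfl
    simp [List.length_flatten]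
  · rintro L rfl L' hL' h
    exact (List.eq_iff_flatten_eq).2 ⟨hL'.symm, h⟩
  · intro ks hks
    induction ks generalizing w with
    | nil => exact ⟨[], by simpa [eq_comm] using hks, rfl⟩
    | cons k ks ih =>
      simp only [Set.mem_ofPred_eq, List.sum_cons] at hks
      obtain ⟨L, hL, rfl⟩ := ih (w.drop k) (by simp only [Set.mem_ofPred_eq]; simp; omega)
      refine ⟨w.take k :: L, ?_, ?_⟩
      · simp only [Set.mem_ofPred_eq] at hL ⊢
        simp [hL]
      · simp
        omega

theorem bijOn_take_drop {α : Type*} (w : List α) :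
    Set.BijOn (fun q : (_ : ℕ) × ℕ => (w.take q.1, (w.drop q.1).take q.2, w.drop (q.1 + q.2)))
      ((Finset.range (w.length + 1)).sigma fun p => Finset.range (w.length + 1 - p) :
        Finset ((_ : ℕ) × ℕ))
      {q : List α × List α × List α | q.1 ++ q.2.1 ++ q.2.2 = w} := by
  refine ⟨?_, ?_, ?_⟩
  · rintro ⟨p, j⟩ -
    simp [← List.drop_drop]
  · rintro ⟨p, j⟩ h ⟨p', j'⟩ h' heq
    simp only [Finset.coe_sigma, Set.mem_sigma_iff, Finset.coe_range, Set.mem_Iio] at h h'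
    simp only [Prod.mk.injEq] at heq
    have h1 := congrArg List.length heq.1
    have h2 := congrArg List.length heq.2.1
    simp only [List.length_take, List.length_drop] at h1 h2
    obtain rfl : p = p' := by omega
    obtain rfl : j = j' := by omega
    rfl
  · rintro ⟨u, v, w'⟩ rfl
    exact ⟨⟨u.length, v.length⟩, by simp; omega, by simp⟩

theorem functorPieces_cons {𝕜 : Type} [CommRing 𝕜] {C D : FilteredCurvedCat 𝕜}
    (F0 : C.Obj → D.E) (Fop : List C.E → D.E) (X : ℕ → C.Obj) (xs : List C.E)
    (k : ℕ) (ks : List ℕ) :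
    functorPieces F0 Fop X xs (k :: ks) =
      (if k = 0 then F0 (X 0) else Fop (xs.take k)) ::
        functorPieces F0 Fop (fun t => X (k + t)) (xs.drop k) ks := by
  simp [functorPieces, List.range_succ_eq_map, List.drop_drop]

theorem CurvedFunctor.functorPieces_eq_pathChain {𝕜 : Type} [CommRing 𝕜]
    {C D : FilteredCurvedCat 𝕜} (F : CurvedFunctor C D) (X : ℕ → C.Obj) (x b : ℕ → C.E) (s : ℕ)
    (L : List (List Bool)) :
    functorPieces F.F0 F.Fop (fun i => X (s + (L.flatten.take i).count true))
      (insertionWord x b s L.flatten) (L.map List.length) = F.pathChain X x b s L := by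
  induction L generalizing s with
  | nil => rfl
  | cons w L ih =>
    rw [List.map_cons, functorPieces_cons, CurvedFunctor.pathChain, ← ih]
    simp only [List.flatten_cons, take_insertionWord, drop_insertionWord]
    congr 1
    · simp [CurvedFunctor.app, isEmpty_insertionWord, List.isEmpty_iff, List.length_eq_zero_iff]
    · simp [List.take_append, List.take_of_length_le, add_assoc]

theorem sum_degree_insertionWord (d : ℕ → ℤ) (w : List Bool) {p : ℕ} (hp : p ≤ w.length) :
    (∑ t ∈ Finset.range p, if w.getD t false then d ((w.take t).count true) else 1) - (p : ℤ) =
      (∑ t ∈ Finset.range ((w.take p).count true), d t) - ((w.take p).count true : ℤ) := by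
  induction p with
  | zero => simp
  | succ p ih =>
    have hp' : p < w.length := hp
    have ih := ih hp'.le
    rw [Finset.sum_range_succ, List.take_add_one, List.getElem?_eq_getElem hp',
      List.getD_eq_getElem _ _ hp']
    rcases h : w[p] with _ | _
    · simp at ih ⊢
      linarith
    · simp [Finset.sum_range_succ] at ih ⊢
      linarith

theorem CurvedFunctor.finsum_pathChain_eq {𝕜 : Type} [CommRing 𝕜]
    {C D : FilteredCurvedCat 𝕜} (F : CurvedFunctor C D) {X : ℕ → C.Obj} {x b : ℕ → C.E}
    {d : ℕ → ℤ} {K : ℕ} (hx : ∀ t < K, C.mem (x t) (X t) (X (t + 1)) (d t))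
    (hb : ∀ t ≤ K, C.mem (b t) (X t) (X t) 1) {w : List Bool} (hw : w.count true = K) :
    ∑ᶠ L ∈ {L : List (List Bool) | L.flatten = w},
        D.opc (F.onObj (X 0)) (F.pathChain X x b 0 L) =
      ∑ᶠ q ∈ {q : List Bool × List Bool × List Bool | q.1 ++ q.2.1 ++ q.2.2 = w},
        (Int.negOnePow ((∑ t ∈ Finset.range (q.1.count true), d t) -
          ((q.1.count true : ℕ) : ℤ)) : ℤ) • F.innerOp X x b q := by
  have key := F.funceq (insertionWord x b 0 w) (fun i => X ((w.take i).count true))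
    (fun i => if w.getD i false then d ((w.take i).count true) else 1) (by
      intro i hi
      rw [length_insertionWord] at hi
      rw [getD_insertionWord _ _ _ hi, List.take_add_one, List.getElem?_eq_getElem hi,
        List.getD_eq_getElem _ _ hi]
      have hle : (w.take i).count true + (w.drop i).count true = w.count true := by
        rw [← List.count_append, List.take_append_drop]
      rw [List.drop_eq_getElem_cons hi] at hle
      rcases h : w[i] with _ | _
      · simpa using hb _ (by omega)
      · rw [h, List.count_cons_self] at hle
        simpa using hx ((w.take i).count true) (by omega))
  rw [length_insertionWord] at key
  convert key using 1
  · rw [finsum_mem_eq_of_bijOn (List.map List.length) (bijOn_map_length w)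
      (g := fun ks => D.opc (F.onObj (X 0))
        (functorPieces F.F0 F.Fop (fun i => X ((w.take i).count true))
          (insertionWord x b 0 w) ks))]
    · refine finsum_congr fun ks => ?_
      by_cases h : ks.sum = w.length <;> simp [h]
    · rintro L rfl
      rw [← F.functorPieces_eq_pathChain]
      simp
  · rw [Finset.sum_sigma', ← finsum_mem_coe_finset]
    refine (finsum_mem_eq_of_bijOn _ (bijOn_take_drop w) ?_).symm
    rintro ⟨p, j⟩ h
    simp only [Finset.coe_sigma, Set.mem_sigma_iff, Finset.coe_range, Set.mem_Iio] at h
    simp only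
    rw [sum_degree_insertionWord d w (by omega)]
    congr 1
    rw [CurvedFunctor.innerOp, take_insertionWord, drop_insertionWord, drop_insertionWord,
      take_insertionWord, FilteredCurvedCat.opc, isEmpty_insertionWord]
    have hj : ((w.drop p).take j).isEmpty = true ↔ j = 0 := by
      rw [List.isEmpty_iff, ← List.length_eq_zero_iff, List.length_take, List.length_drop]
      omega
    simp only [hj, zero_add, List.take_add, List.count_append]

/-- Summing the functor equations over all paths that make `K` steps. -/
theorem CurvedFunctor.RespectsFilt.finsum_pathChain_eq {𝕜 : Type} [CommRing 𝕜]
    {C D : FilteredCurvedCat 𝕜} {F : CurvedFunctor C D} (hF : F.RespectsFilt)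
    (hD : D.FiltBoundedAbove) {X : ℕ → C.Obj} {x b : ℕ → C.E}
    {d : ℕ → ℤ} {K : ℕ} (hxm : ∀ t < K, C.mem (x t) (X t) (X (t + 1)) (d t))
    (hbm : ∀ t ≤ K, C.mem (b t) (X t) (X t) 1) {Λ ε : ℝ} (hε : 0 < ε)
    (hmu : ∀ t ≤ K, C.mu0 (X t) ∈ C.filt 0)
    (hx : ∀ t, x t ∈ C.filt Λ) (hb : ∀ t ≤ K, b t ∈ C.filt ε)
    (hF0 : ∀ t ≤ K, F.F0 (X t) ∈ D.filt ε) :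
    ∑ᶠ L ∈ {L : List (List Bool) | L.flatten.count true = K},
        D.opc (F.onObj (X 0)) (F.pathChain X x b 0 L) =
      ∑ᶠ q ∈ {q : List Bool × List Bool × List Bool |
          q.1.count true + q.2.1.count true + q.2.2.count true = K},
        (Int.negOnePow ((∑ t ∈ Finset.range (q.1.count true), d t) -
          ((q.1.count true : ℕ) : ℤ)) : ℤ) • F.innerOp X x b q := by
  have hfin := hF.finite_pathChain hD hε hx hb hF0 (F.onObj (X 0)) [] (Nat.zero_add K).le
  simp only [List.nil_append] at hfin
  rw [finsum_mem_fiberwise (s := {L : List (List Bool) | L.flatten.count true = K})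
    (t := {w : List Bool | w.count true = K}) (g := List.flatten) (fun L hL => hL) hfin]
  rw [finsum_mem_fiberwise (t := {w : List Bool | w.count true = K})
    (g := fun q => q.1 ++ q.2.1 ++ q.2.2) (fun q hq => by simpa [add_assoc] using hq)
    ((hF.finite_innerOp hD hε hmu hx hb).subset fun q hq =>
      ⟨hq.1, fun h => hq.2 (by simp only [h, smul_zero])⟩)]
  refine finsum_mem_congr rfl fun w hw => ?_
  refine (finsum_mem_congr (Set.ext fun L => ?_) fun _ _ => rfl).trans
    ((F.finsum_pathChain_eq hxm hbm hw).trans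
      (finsum_mem_congr (Set.ext fun q => ?_) fun _ _ => rfl))
  · simp only [Set.mem_inter_iff, Set.mem_preimage, Set.mem_singleton_iff, Set.mem_ofPred_eq]
    exact and_iff_right_of_imp fun h => h ▸ hw
  · simp only [Set.mem_inter_iff, Set.mem_preimage, Set.mem_singleton_iff, Set.mem_ofPred_eq]
    refine (and_iff_right_of_imp fun h => ?_).symm
    rw [← List.count_append, ← List.count_append, h]
    exact hw

/-- The operation `op` as an additive map in one of its inputs. -/
def FilteredCurvedCat.opHom {𝕜 : Type} [CommRing 𝕜] (C : FilteredCurvedCat 𝕜)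
    (ys zs : List C.E) : C.E →+ C.E :=
  AddMonoidHom.mk' (fun y => C.op (ys ++ y :: zs)) (C.op_add ys zs)

theorem FilteredCurvedCat.opc_append_cons {𝕜 : Type} [CommRing 𝕜] (C : FilteredCurvedCat 𝕜)
    (Y : C.Obj) (ys zs : List C.E) (y : C.E) :
    C.opc Y (ys ++ y :: zs) = C.opHom ys zs y := by
  simp [FilteredCurvedCat.opc, FilteredCurvedCat.opHom]

/-- The sum of the values of a curved functor over all words spelled by paths that start at `s`
and make `m` steps. -/
noncomputable def CurvedFunctor.pathSum {𝕜 : Type} [CommRing 𝕜] {C D : FilteredCurvedCat 𝕜}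
    (F : CurvedFunctor C D) (X : ℕ → C.Obj) (x b : ℕ → C.E) (s m : ℕ) : D.E :=
  ∑ᶠ w ∈ {w : List Bool | w.count true = m}, F.app (X s) (insertionWord x b s w)

/-- The chain of path sums with successive step numbers. -/
noncomputable def CurvedFunctor.sumChain {𝕜 : Type} [CommRing 𝕜] {C D : FilteredCurvedCat 𝕜}
    (F : CurvedFunctor C D) (X : ℕ → C.Obj) (x b : ℕ → C.E) : ℕ → List ℕ → List D.E
  | _, [] => []
  | s, m :: ks => F.pathSum X x b s m :: F.sumChain X x b (s + m) ks

section collapse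

variable {𝕜 : Type} [CommRing 𝕜] {C D : FilteredCurvedCat 𝕜} {F : CurvedFunctor C D}
  {X : ℕ → C.Obj} {x b : ℕ → C.E} {K : ℕ} {Λ ε : ℝ}

theorem CurvedFunctor.RespectsFilt.opc_sumChain (hF : F.RespectsFilt)
    (hD : D.FiltBoundedAbove)
    (hε : 0 < ε) (hx : ∀ t, x t ∈ C.filt Λ) (hb : ∀ t ≤ K, b t ∈ C.filt ε)
    (hF0 : ∀ t ≤ K, F.F0 (X t) ∈ D.filt ε) (Y : D.Obj) (pre : List D.E) {s : ℕ}
    {ks : List ℕ} (hks : s + ks.sum ≤ K) :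
    D.opc Y (pre ++ F.sumChain X x b s ks) =
      ∑ᶠ L ∈ {L : List (List Bool) | L.map (List.count true) = ks},
        D.opc Y (pre ++ F.pathChain X x b s L) := by
  induction ks generalizing s pre with
  | nil =>
    simp only [List.map_eq_nil_iff, Set.ofPred_eq_eq_singleton, finsum_mem_singleton]
    rfl
  | cons m ks ih =>
    rw [List.sum_cons] at hks
    have hfin := hF.finite_pathChain hD hε hx hb hF0 Y pre hks
    rw [CurvedFunctor.sumChain, FilteredCurvedCat.opc_append_cons, CurvedFunctor.pathSum,
      AddMonoidHom.map_finsum_mem' _ (hF.finite_app hD hε hx hb hF0 (by omega)),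
      finsum_mem_fiberwise (s := {L : List (List Bool) | L.map (List.count true) = m :: ks})
        (t := {w : List Bool | w.count true = m}) (g := fun L => L.headD [])]
    · refine finsum_mem_congr rfl fun w hw => ?_
      rw [← FilteredCurvedCat.opc_append_cons, ← List.singleton_append, ← List.append_assoc,
        ih _ (by omega)]
      refine finsum_mem_eq_of_bijOn (List.cons w) ⟨?_, ?_, ?_⟩ ?_
      · rintro L rfl
        exact ⟨by simpa using hw, rfl⟩
      · exact fun L _ L' _ h => (List.cons.inj h).2
      · rintro (_ | ⟨v, L⟩) ⟨hL, rfl⟩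
        · simp at hL
        · exact ⟨L, (List.cons.inj hL).2, rfl⟩
      · rintro L -
        simp only [Set.mem_ofPred_eq] at hw
        simp [CurvedFunctor.pathChain, hw]
    · rintro (_ | ⟨v, L⟩) hL
      · simp at hL
      · exact (List.cons.inj hL).1
    · refine hfin.subset (Set.inter_subset_inter_left _ fun L hL => ?_)
      simp only [Set.mem_ofPred_eq] at hL ⊢
      rw [List.count_flatten, hL, List.sum_cons]

theorem CurvedFunctor.RespectsFilt.finsum_sumChain (hF : F.RespectsFilt)
    (hD : D.FiltBoundedAbove)
    (hε : 0 < ε) (hx : ∀ t, x t ∈ C.filt Λ) (hb : ∀ t ≤ K, b t ∈ C.filt ε)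
    (hF0 : ∀ t ≤ K, F.F0 (X t) ∈ D.filt ε) (Y : D.Obj) :
    ({ks | ks.sum = K} ∩ Function.support fun ks => D.opc Y (F.sumChain X x b 0 ks)).Finite ∧
    ∑ᶠ L ∈ {L : List (List Bool) | L.flatten.count true = K},
        D.opc Y (F.pathChain X x b 0 L) =
      ∑ᶠ ks ∈ {ks : List ℕ | ks.sum = K}, D.opc Y (F.sumChain X x b 0 ks) := by
  have hfin := hF.finite_pathChain hD hε hx hb hF0 Y [] (Nat.zero_add K).le
  have hT {ks : List ℕ} (hks : ks.sum = K) :=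
    hF.opc_sumChain hD hε hx hb hF0 Y [] (s := 0) (ks := ks) (by omega)
  simp only [List.nil_append] at hfin hT
  constructor
  · refine (hfin.image (List.map (List.count true))).subset ?_
    rintro ks ⟨hks, hne⟩
    simp only [Function.mem_support] at hne
    rw [hT hks] at hne
    obtain ⟨L, rfl, hL⟩ := exists_ne_zero_of_finsum_mem_ne_zero hne
    exact ⟨L, ⟨by simpa [List.count_flatten] using hks, hL⟩, rfl⟩
  · rw [finsum_mem_fiberwise (t := {ks : List ℕ | ks.sum = K})
      (g := List.map (List.count true)) (fun L hL => by simpa [List.count_flatten] using hL) hfin]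
    refine finsum_mem_congr rfl fun ks hks => ?_
    rw [hT hks]
    congr! 3 with L
    simp only [Set.mem_inter_iff, Set.mem_preimage, Set.mem_singleton_iff, Set.mem_ofPred_eq]
    refine and_iff_right_of_imp ?_
    rintro rfl
    simpa [List.count_flatten] using hks

theorem CurvedFunctor.sumChain_insertionWord {c sz : ℕ → ℕ} (h : ∀ i, sz (i + 1) = sz i + c i)
    (i : ℕ) (v : List Bool) :
    F.sumChain X x b (sz i) (insertionWord c (fun _ => 0) i v) =
      insertionWord (fun i => F.pathSum X x b (sz i) (c i))
        (fun i => F.pathSum X x b (sz i) 0) i v := by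
  induction v generalizing i with
  | nil => rfl
  | cons a v ih => cases a <;> simp [CurvedFunctor.sumChain, ih, ← h]

end collapse

theorem insertionWord_getD_cons {α : Type*} (z a : α) (l : List α) (v : List Bool) :
    insertionWord (fun t => (a :: l).getD t z) (fun _ => z) 1 v =
      insertionWord (fun t => l.getD t z) (fun _ => z) 0 v :=
  insertionWord_congr (by simp [add_comm]) (by simp)

/-- Lists of natural numbers with prescribed nonzero entries correspond to paths. -/
theorem bijOn_filter_ne_zero {l : List ℕ} (hl : ∀ a ∈ l, 0 < a) :
    Set.BijOn (insertionWord (fun t => l.getD t 0) (fun _ => 0) 0)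
      {v | v.count true = l.length} {ks : List ℕ | ks.filter (· ≠ 0) = l} := by
  refine ⟨?_, Set.LeftInvOn.injOn (f₁' := List.map (· ≠ 0)) ?_, ?_⟩
  · intro v hv
    simp only [Set.mem_ofPred_eq] at hv ⊢
    induction v generalizing l with
    | nil => simpa [eq_comm] using hv
    | cons a v ih =>
      cases a
      · simpa using ih hl (by simpa using hv)
      · cases l with
        | nil => simp at hv
        | cons a l =>
          simp only [List.mem_cons, forall_eq_or_imp] at hl
          have := ih hl.2 (by simpa using hv)
          rw [insertionWord_true, zero_add, insertionWord_getD_cons]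
          simpa [hl.1.ne'] using this
  · intro v hv
    simp only [Set.mem_ofPred_eq] at hv
    induction v generalizing l with
    | nil => rfl
    | cons a v ih =>
      cases a
      · simpa using ih hl (by simpa using hv)
      · cases l with
        | nil => simp at hv
        | cons a l =>
          simp only [List.mem_cons, forall_eq_or_imp] at hl
          have := ih hl.2 (by simpa using hv)
          rw [insertionWord_true, zero_add, insertionWord_getD_cons]
          simpa [hl.1.ne'] using this
  · rintro ks rfl
    clear hl
    refine ⟨ks.map (· ≠ 0), ?_, ?_⟩
    · simp only [Set.mem_ofPred_eq]
      induction ks with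
      | nil => rfl
      | cons k ks ih => cases k <;> simp_all
    · induction ks with
      | nil => rfl
      | cons k ks ih =>
        cases k
        · simpa using ih
        · simp only [List.map_cons, ne_eq, Nat.add_eq_zero_iff, one_ne_zero, and_false,
            not_false_eq_true, decide_true, insertionWord_true, List.filter_cons_of_pos, zero_add,
            insertionWord_getD_cons]
          simpa using ih

theorem bijOn_blocks (K : ℕ) :
    Set.BijOn (fun c : Composition K => c.blocks) Set.univ
      {l : List ℕ | l.sum = K ∧ ∀ a ∈ l, 0 < a} :=
  ⟨fun c _ => ⟨c.blocks_sum, fun _ => c.blocks_pos⟩, fun _ _ _ _ h => Composition.ext h,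
    fun l hl => ⟨⟨l, hl.2 _, hl.1⟩, trivial, rfl⟩⟩

theorem finsum_sum_eq_composition {M : Type*} [AddCommMonoid M] {K : ℕ} {f : List ℕ → M}
    (hf : ({ks | ks.sum = K} ∩ Function.support f).Finite) :
    ∑ᶠ ks ∈ {ks : List ℕ | ks.sum = K}, f ks =
      ∑ c : Composition K, ∑ᶠ v ∈ {v : List Bool | v.count true = c.length},
        f (insertionWord (fun t => c.blocks.getD t 0) (fun _ => 0) 0 v) := by
  have hsum (ks : List ℕ) : (ks.filter (· ≠ 0)).sum = ks.sum := by
    induction ks with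
    | nil => rfl
    | cons k ks ih => cases k <;> simp_all
  rw [finsum_mem_fiberwise (s := {ks : List ℕ | ks.sum = K})
    (t := {l : List ℕ | l.sum = K ∧ ∀ a ∈ l, 0 < a})
    (g := List.filter (· ≠ 0)) (fun ks hks => ⟨(hsum ks).trans hks, fun a ha => by
      simpa [Nat.pos_iff_ne_zero] using (List.mem_filter.1 ha).2⟩) hf,
    ← finsum_eq_sum_of_fintype]
  refine Eq.symm ((finsum_mem_univ _).symm.trans
    (finsum_mem_eq_of_bijOn _ (bijOn_blocks K) fun c _ => ?_))
  refine ((finsum_mem_eq_of_bijOn (g := f) _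
    (bijOn_filter_ne_zero (l := c.blocks) fun a => c.blocks_pos) fun v _ => rfl).trans
      (finsum_mem_congr (Set.ext fun ks => ?_) fun _ _ => rfl))
  simp only [Set.mem_inter_iff, Set.mem_preimage, Set.mem_singleton_iff, Set.mem_ofPred_eq]
  refine (and_iff_right_of_imp fun h => ?_).symm
  rw [← hsum, h, c.blocks_sum]

theorem FilteredCurvedCat.exists_pos_forall_filt {𝕜 : Type} [CommRing 𝕜]
    (C : FilteredCurvedCat 𝕜) {y : ℕ → C.E} {K : ℕ}
    (h : ∀ t ≤ K, ∃ l > (0 : ℝ), y t ∈ C.filt l) : ∃ ε > (0 : ℝ), ∀ t ≤ K, y t ∈ C.filt ε := by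
  choose! l hl hy using h
  have hne : (Finset.range (K + 1)).Nonempty := ⟨0, by simp⟩
  refine ⟨(Finset.range (K + 1)).inf' hne l, ?_, fun t ht => ?_⟩
  · rw [gt_iff_lt, Finset.lt_inf'_iff]
    exact fun t ht => hl t (Nat.lt_succ_iff.1 (Finset.mem_range.1 ht))
  · exact C.filt_antitone (Finset.inf'_le _ (by simpa [Nat.lt_succ_iff] using ht)) (hy t ht)

theorem FilteredCurvedCat.exists_forall_getD_filt {𝕜 : Type} [CommRing 𝕜]
    (C : FilteredCurvedCat 𝕜) (xs : List C.E) : ∃ Λ : ℝ, ∀ t, xs.getD t 0 ∈ C.filt Λ := by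
  induction xs with
  | nil => exact ⟨0, fun t => by simpa using C.filt_zero 0⟩
  | cons a xs ih =>
    obtain ⟨Λ, h⟩ := ih
    obtain ⟨l, hl⟩ := C.filt_exhaustive a
    refine ⟨min l Λ, fun t => ?_⟩
    cases t with
    | zero => exact C.filt_antitone (min_le_left _ _) hl
    | succ t => exact C.filt_antitone (min_le_right _ _) (h t)

theorem finsum_expand_take_drop {𝕜 : Type} [CommRing 𝕜] (C : FilteredCurvedCat 𝕜) {M : Type*}
    [AddCommMonoid M] (f : List C.E → M) (xs : List C.E) (b : ℕ → C.E) {s m : ℕ}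
    (h : s + m ≤ xs.length) :
    ∑ᶠ l : Fin (((xs.drop s).take m).length + 1) → ℕ,
        f (C.expand ((xs.drop s).take m) (fun t => b (s + t)) l) =
      ∑ᶠ w ∈ {w : List Bool | w.count true = m},
        f (insertionWord (fun t => xs.getD t 0) b s w) := by
  have hlen : ((xs.drop s).take m).length = m := by simp; omega
  rw [finsum_expand, hlen]
  refine finsum_mem_congr rfl fun w hw => congrArg f (insertionWord_congr ?_ ?_)
  · intro t ht
    simp only [Set.mem_ofPred_eq] at hw
    simp [List.getElem?_drop, hw ▸ ht]
  · simp

theorem bijOn_append_true (p m : ℕ) :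
    Set.BijOn (fun q : List Bool × List Bool => q.1 ++ true :: q.2)
      ({u | u.count true = p} ×ˢ {w | w.count true = m}) {w | w.count true = p + m + 1} := by
  refine ⟨?_, ?_, ?_⟩
  · rintro ⟨u, w⟩ ⟨rfl, rfl⟩
    simp [add_assoc]
  · rintro ⟨u, w⟩ ⟨hu, -⟩ ⟨u', w'⟩ ⟨hu', -⟩ h
    simp only [Set.mem_ofPred_eq] at hu hu' h
    have huu : u.count true = u'.count true := hu.trans hu'.symm
    clear hu hu'
    induction u generalizing u' with
    | nil =>
      cases u' with
      | nil => simpa using h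
      | cons a u' => cases a <;> simp at h huu
    | cons a u ih =>
      cases u' with
      | nil => cases a <;> simp at h huu
      | cons a' u' =>
        simp only [List.cons_append, List.cons.injEq] at h
        obtain ⟨rfl, h⟩ := h
        simpa using ih u' h (by simpa [List.count_cons] using huu)
  · intro w hw
    simp only [Set.mem_ofPred_eq] at hw
    induction w generalizing p with
    | nil => simp at hw
    | cons a w ih =>
      cases a
      · obtain ⟨⟨u, v⟩, ⟨hu, hv⟩, rfl⟩ := ih p (by simpa using hw)
        exact ⟨(false :: u, v), ⟨by simpa using hu, hv⟩, rfl⟩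
      · cases p with
        | zero => exact ⟨([], w), ⟨rfl, by simpa using hw⟩, rfl⟩
        | succ p =>
          rw [List.count_cons_self] at hw
          obtain ⟨⟨u, v⟩, ⟨hu, hv⟩, rfl⟩ := ih p (by omega)
          exact ⟨(true :: u, v), ⟨by simpa using hu, hv⟩, rfl⟩

section innerOp

variable {𝕜 : Type} [CommRing 𝕜] {C D : FilteredCurvedCat 𝕜} (F : CurvedFunctor C D)

/-- The map `Fop` as an additive map in one of its inputs. -/
def CurvedFunctor.fopHom (ys zs : List C.E) : C.E →+ D.E :=
  AddMonoidHom.mk' (fun y => F.Fop (ys ++ y :: zs)) (F.Fop_add ys zs)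

theorem CurvedFunctor.fopHom_apply (ys zs : List C.E) (y : C.E) :
    F.fopHom ys zs y = F.Fop (ys ++ y :: zs) := rfl

theorem CurvedFunctor.deformed_take_append_cons_drop (Y : C.Obj) (xs : List C.E) (b : ℕ → C.E)
    (y : C.E) {p j : ℕ} (hj : 1 ≤ j) (hpj : p + j ≤ xs.length) :
    F.deformed Y (xs.take p ++ y :: xs.drop (p + j))
        (fun t => if t ≤ p then b t else b (t + j - 1)) =
      ∑ᶠ q ∈ ({u | u.count true = p} ×ˢ {w | w.count true = xs.length - p - j} :
          Set (List Bool × List Bool)),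
        F.Fop (insertionWord (fun t => xs.getD t 0) b 0 q.1 ++
          y :: insertionWord (fun t => xs.getD t 0) b (p + j) q.2) := by
  rw [CurvedFunctor.deformed, finsum_expand]
  have hlen : (xs.take p ++ y :: xs.drop (p + j)).length = p + (xs.length - p - j) + 1 := by
    simp
    omega
  rw [hlen]
  refine (finsum_mem_eq_of_bijOn _ (bijOn_append_true _ _) ?_).symm
  rintro ⟨u, w⟩ ⟨hu, hw⟩
  simp only [Set.mem_ofPred_eq] at hu hw
  have hp : (xs.take p).length = p := by simp; omega
  simp only
  rw [insertionWord_append, hu, zero_add, insertionWord_true,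
    List.getD_append_right _ _ _ _ hp.le, hp, Nat.sub_self, List.getD_cons_zero]
  rw [CurvedFunctor.app, if_neg (by simp)]
  congr 2
  · refine insertionWord_congr (fun t ht => ?_) (fun t ht => ?_)
    · rw [hu] at ht
      simp only [zero_add]
      rw [List.getD_append _ _ _ _ (by omega)]
      simp [ht]
    · simp [hu ▸ ht]
  · congr 1
    refine insertionWord_congr (fun t ht => ?_) (fun t ht => ?_)
    · rw [List.getD_append_right _ _ _ _ (by omega), hp,
        show p + 1 + t - p = t + 1 by omega, List.getD_cons_succ]
      simp [List.getElem?_drop]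
    · rw [if_neg (by omega)]
      congr 1
      omega

/-- The sum of the values of the curved operations over all words spelled by paths that start at
`s` and make `m` steps. -/
noncomputable def FilteredCurvedCat.pathOp (C : FilteredCurvedCat 𝕜) (X : ℕ → C.Obj)
    (x b : ℕ → C.E) (s m : ℕ) : C.E :=
  ∑ᶠ w ∈ {w : List Bool | w.count true = m}, C.opc (X s) (insertionWord x b s w)

variable {F} {X : ℕ → C.Obj} {x b : ℕ → C.E} {K : ℕ} {Λ ε : ℝ}

theorem CurvedFunctor.RespectsFilt.finsum_innerOp_fiber (hF : F.RespectsFilt)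
    (hC : C.FiltBoundedAbove) (hD : D.FiltBoundedAbove) (hε : 0 < ε)
    (hmu : ∀ t ≤ K, C.mu0 (X t) ∈ C.filt 0)
    (hx : ∀ t, x t ∈ C.filt Λ) (hb : ∀ t ≤ K, b t ∈ C.filt ε) {p j : ℕ} (hpj : p + j ≤ K) :
    ∑ᶠ q ∈ {q : List Bool × List Bool × List Bool |
        q.1.count true = p ∧ q.2.1.count true = j ∧ q.2.2.count true = K - p - j},
      F.innerOp X x b q =
    ∑ᶠ q ∈ ({u | u.count true = p} ×ˢ {w | w.count true = K - p - j} :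
        Set (List Bool × List Bool)),
      F.Fop (insertionWord x b 0 q.1 ++ C.pathOp X x b p j :: insertionWord x b (p + j) q.2) := by
  rw [finsum_mem_fiberwise (t := {u | u.count true = p} ×ˢ {w | w.count true = K - p - j})
    (g := fun q => (q.1, q.2.2)) (fun q hq => ⟨hq.1, hq.2.2⟩)
    ((hF.finite_innerOp hD hε hmu hx hb).subset (Set.inter_subset_inter_left _ ?_))]
  · refine finsum_mem_congr rfl ?_
    rintro ⟨u, w⟩ ⟨hu, hw⟩
    simp only [Set.mem_ofPred_eq] at hu hw
    rw [← F.fopHom_apply, FilteredCurvedCat.pathOp,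
      AddMonoidHom.map_finsum_mem' _ (FilteredCurvedCat.finite_opc hC hε hmu hx hb hpj)]
    refine (finsum_mem_eq_of_bijOn (fun v => (u, v, w)) ⟨?_, ?_, ?_⟩ ?_).symm
    · exact fun v hv => ⟨⟨hu, hv, hw⟩, rfl⟩
    · intro v _ v' _ h
      simpa using h
    · rintro ⟨u', v, w'⟩ ⟨⟨-, hv, -⟩, h⟩
      simp only [Set.mem_preimage, Set.mem_singleton_iff, Prod.mk.injEq] at h
      exact ⟨v, hv, by simp [h]⟩
    · intro v hv
      simp only [Set.mem_ofPred_eq] at hv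
      simp [CurvedFunctor.innerOp, F.fopHom_apply, hu, hv]
  · rintro q ⟨h1, h2, h3⟩
    simp only [Set.mem_ofPred_eq]
    omega

theorem CurvedFunctor.RespectsFilt.finsum_innerOp (hF : F.RespectsFilt)
    (hC : C.FiltBoundedAbove) (hD : D.FiltBoundedAbove) (hε : 0 < ε)
    (hmu : ∀ t ≤ K, C.mu0 (X t) ∈ C.filt 0)
    (hx : ∀ t, x t ∈ C.filt Λ) (hb : ∀ t ≤ K, b t ∈ C.filt ε)
    (hMC : ∀ p ≤ K, C.pathOp X x b p 0 = 0) (σ : ℕ → ℤ) :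
    ∑ᶠ q ∈ {q : List Bool × List Bool × List Bool |
        q.1.count true + q.2.1.count true + q.2.2.count true = K},
      σ (q.1.count true) • F.innerOp X x b q =
    ∑ p ∈ Finset.range (K + 1), ∑ j ∈ Finset.Icc 1 (K - p), σ p •
      ∑ᶠ q ∈ ({u | u.count true = p} ×ˢ {w | w.count true = K - p - j} :
          Set (List Bool × List Bool)),
        F.Fop (insertionWord x b 0 q.1 ++
          C.pathOp X x b p j :: insertionWord x b (p + j) q.2) := by
  have hfin := hF.finite_innerOp hD hε hmu hx hb
  have hfiber {p j : ℕ} (hpj : p + j ≤ K) :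
      {q : List Bool × List Bool × List Bool |
          q.1.count true + q.2.1.count true + q.2.2.count true = K} ∩
        (fun q => (⟨q.1.count true, q.2.1.count true⟩ : (_ : ℕ) × ℕ)) ⁻¹' {⟨p, j⟩} =
      {q | q.1.count true = p ∧ q.2.1.count true = j ∧ q.2.2.count true = K - p - j} := by
    ext q
    simp only [Set.mem_inter_iff, Set.mem_preimage, Set.mem_singleton_iff, Set.mem_ofPred_eq,
      Sigma.mk.injEq, heq_eq_eq]
    omega
  rw [finsum_mem_fiberwise
    (s := {q : List Bool × List Bool × List Bool |
        q.1.count true + q.2.1.count true + q.2.2.count true = K})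
    (t := ((Finset.range (K + 1)).sigma fun p => Finset.range (K + 1 - p) :
      Finset ((_ : ℕ) × ℕ)))
    (g := fun q => (⟨q.1.count true, q.2.1.count true⟩ : (_ : ℕ) × ℕ)) (fun q hq => by
      simp only [Set.mem_ofPred_eq] at hq
      simp only [SetLike.mem_coe, Finset.mem_sigma, Finset.mem_range]
      omega)
    (hfin.subset fun q hq => ⟨hq.1, fun h => hq.2 (by simp only [h, smul_zero])⟩),
    finsum_mem_coe_finset, Finset.sum_sigma]
  refine Finset.sum_congr rfl fun p hp => ?_
  have hp : p ≤ K := Nat.lt_succ_iff.1 (Finset.mem_range.1 hp)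
  have hterm {j : ℕ} (hpj : p + j ≤ K) := hF.finsum_innerOp_fiber hC hD hε hmu hx hb hpj
  refine Eq.trans (Finset.sum_congr rfl fun j hj => ?_)
    (Finset.sum_subset (fun j hj => ?_) fun j hj hj' => ?_).symm
  · have hpj : p + j ≤ K := by
      have := Finset.mem_range.1 hj
      omega
    rw [← hterm hpj, hfiber hpj, ← zsmulAddGroupHom_apply,
      AddMonoidHom.map_finsum_mem' _ (hfin.subset (Set.inter_subset_inter_left _ ?_))]
    · exact finsum_mem_congr rfl fun q hq => by rw [hq.1, zsmulAddGroupHom_apply]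
    · rw [← hfiber hpj]
      exact Set.inter_subset_left
  · simp only [Finset.mem_Icc, Finset.mem_range] at hj ⊢
    omega
  · obtain rfl : j = 0 := by
      simp only [Finset.mem_Icc, Finset.mem_range] at hj hj'
      omega
    simp only [hMC p hp, ← F.fopHom_apply, map_zero, finsum_zero, smul_zero]

end innerOp


theorem CurvedFunctor.deformedOp_eq_finsum_sumChain {𝕜 : Type} [CommRing 𝕜]
    {C D : FilteredCurvedCat 𝕜} (F : CurvedFunctor C D) (X : ℕ → C.Obj) (xs : List C.E)
    (b : ℕ → C.E) (Y : D.Obj) (c : Composition xs.length) :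
    D.deformedOp Y
        ((List.range c.length).map fun i =>
          F.deformed (X (c.sizeUpTo i)) ((xs.drop (c.sizeUpTo i)).take (c.blocks.getD i 0))
            fun t => b (c.sizeUpTo i + t))
        (fun i => F.pushforward (X (c.sizeUpTo i)) (b (c.sizeUpTo i))) =
      ∑ᶠ v ∈ {v : List Bool | v.count true = c.length},
        D.opc Y (F.sumChain X (fun t => xs.getD t 0) b 0
          (insertionWord (fun t => c.blocks.getD t 0) (fun _ => 0) 0 v)) := by
  have hsz (i : ℕ) : c.sizeUpTo (i + 1) = c.sizeUpTo i + c.blocks.getD i 0 := by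
    by_cases hi : i < c.length
    · rw [c.sizeUpTo_succ hi, List.getD_eq_getElem]
    · have hi : c.length ≤ i := not_lt.1 hi
      rw [c.sizeUpTo_ofLength_le _ hi, c.sizeUpTo_ofLength_le _ (hi.trans i.le_succ),
        List.getD_eq_default _ _ hi, add_zero]
  refine (finsum_expand D (D.opc Y) _ _).trans ?_
  rw [List.length_map, List.length_range]
  refine finsum_mem_congr rfl fun v hv => congrArg (D.opc Y) ?_
  simp only [Set.mem_ofPred_eq] at hv
  have key := F.sumChain_insertionWord (X := X) (x := fun t => xs.getD t 0) (b := b) hsz 0 v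
  rw [c.sizeUpTo_zero] at key
  rw [key]
  refine insertionWord_congr (fun t ht => ?_) (fun t _ => ?_)
  · rw [hv] at ht
    rw [zero_add, List.getD_eq_getElem _ _ (by simpa using ht), List.getElem_map,
      List.getElem_range]
    refine finsum_expand_take_drop C (F.app (X (c.sizeUpTo t))) xs b ?_
    rw [← hsz]
    exact c.sizeUpTo_le _
  · exact finsum_replicate (F.app _) _ b _

/-- Let `F : A → B` be a curved A∞-functor between curved A∞-categories
over `𝕜` with bounded-above ℝ-filtrations, respecting the filtrations, and let `B'` be an
unobstructed deformation of `A` (Maurer–Cartan elements `b X` for the objects `X` of the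
subcollection `S`); let `F_* B'` be the pushforward deformation of `B`, consisting of the
Maurer–Cartan elements `F_* (b X)`.  The zeroth deformed term
`F^{0;b}(1) = ∑_{m ≥ 0} F^m(b, …, b) − F_* b` equals `0`, and the deformed components
`F^{k; b₀, …, b_k}` (for `k ≥ 1`) satisfy the (uncurved) A∞-functor equations with respect
to the deformed structure maps; i.e. they define an A∞-functor
`F_{B'} : A(B') → B(F_* B')` between ordinary A∞-categories, sending `(X, b)` to
`(F(X), F_* b)` on objects. -/
theorem deformed_functor_is_ainfty_functor
    {𝕜 : Type} [CommRing 𝕜] (C D : FilteredCurvedCat 𝕜)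
    (hbdC : C.FiltBoundedAbove) (hbdD : D.FiltBoundedAbove)
    (F : CurvedFunctor C D) (hF : F.RespectsFilt)
    (S : Set C.Obj) (b : C.Obj → C.E)
    (hMC : ∀ X ∈ S, C.IsMaurerCartan X (b X)) :
    -- the zeroth-order term of the deformed functor vanishes
    (∀ X ∈ S,
      (∑ᶠ n : ℕ, F.app X (List.replicate n (b X))) - F.pushforward X (b X) = 0) ∧
    -- the (uncurved) A∞-functor equations for the deformed components, `k ≥ 1`
    (∀ (xs : List C.E) (X : ℕ → C.Obj) (d : ℕ → ℤ), xs ≠ [] →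
      (∀ i, X i ∈ S) →
      (∀ i < xs.length, C.mem (xs.getD i 0) (X i) (X (i + 1)) (d i)) →
      (∑ c : Composition xs.length,
          D.deformedOp (F.onObj (X 0))
            ((List.range c.length).map fun i =>
              F.deformed (X (c.sizeUpTo i))
                ((xs.drop (c.sizeUpTo i)).take (c.blocks.getD i 0))
                (fun t => b (X (c.sizeUpTo i + t))))
            (fun i => F.pushforward (X (c.sizeUpTo i)) (b (X (c.sizeUpTo i))))) =
      ∑ p ∈ Finset.range (xs.length + 1), ∑ j ∈ Finset.Icc 1 (xs.length - p),
        (Int.negOnePow ((∑ t ∈ Finset.range p, d t) - (p : ℤ)) : ℤ) •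
          F.deformed (X 0)
            (xs.take p ++
              C.deformedOp (X p) ((xs.drop p).take j) (fun t => b (X (p + t))) ::
                xs.drop (p + j))
            (fun t => if t ≤ p then b (X t) else b (X (t + j - 1)))) := by
  refine ⟨fun X _ => sub_self _, fun xs X d _ hS hmem => ?_⟩
  obtain ⟨Λ, hx⟩ := C.exists_forall_getD_filt xs
  obtain ⟨ε₁, hε₁, hb₁⟩ := C.exists_pos_forall_filt (y := fun t => b (X t)) (K := xs.length)
    fun t _ => (hMC _ (hS t)).2.1
  obtain ⟨ε₂, hε₂, hF₂⟩ := D.exists_pos_forall_filt (y := fun t => F.F0 (X t))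
    (K := xs.length) fun t _ => hF.1 (X t)
  have hε : 0 < min ε₁ ε₂ := lt_min hε₁ hε₂
  have hb : ∀ t ≤ xs.length, b (X t) ∈ C.filt (min ε₁ ε₂) :=
    fun t ht => C.filt_antitone (min_le_left _ _) (hb₁ t ht)
  have hF0 : ∀ t ≤ xs.length, F.F0 (X t) ∈ D.filt (min ε₁ ε₂) :=
    fun t ht => D.filt_antitone (min_le_right _ _) (hF₂ t ht)
  have hmu : ∀ t ≤ xs.length, C.mu0 (X t) ∈ C.filt 0 := fun t _ => by
    obtain ⟨l, hl, h⟩ := C.filt_mu0 (X t)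
    exact C.filt_antitone hl.le h
  have hMC' : ∀ p ≤ xs.length,
      C.pathOp X (fun t => xs.getD t 0) (fun t => b (X t)) p 0 = 0 := fun p _ =>
    (finsum_replicate (C.opc (X p)) _ (fun t => b (X t)) p).symm.trans (hMC _ (hS p)).2.2
  obtain ⟨hfin, hcollapse⟩ := hF.finsum_sumChain hbdD hε hx hb hF0 (F.onObj (X 0))
  refine (Finset.sum_congr rfl fun c _ =>
    F.deformedOp_eq_finsum_sumChain X xs (fun t => b (X t)) (F.onObj (X 0)) c).trans ?_
  rw [← finsum_sum_eq_composition hfin, ← hcollapse,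
    hF.finsum_pathChain_eq hbdD hmem (fun t _ => (hMC _ (hS t)).1) hε hmu hx hb hF0,
    hF.finsum_innerOp hbdC hbdD hε hmu hx hb hMC'
      (fun p => (Int.negOnePow ((∑ t ∈ Finset.range p, d t) - (p : ℤ)) : ℤ))]
  refine Finset.sum_congr rfl fun p hp => Finset.sum_congr rfl fun j hj => ?_
  rw [Finset.mem_range] at hp
  rw [Finset.mem_Icc] at hj
  have hpj : p + j ≤ xs.length := by omega
  rw [F.deformed_take_append_cons_drop (X 0) xs (fun t => b (X t)) _ hj.1 hpj]
  have hop : C.deformedOp (X p) ((xs.drop p).take j) (fun t => b (X (p + t))) =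
      C.pathOp X (fun t => xs.getD t 0) (fun t => b (X t)) p j :=
    finsum_expand_take_drop C (C.opc (X p)) xs (fun t => b (X t)) hpj
  rw [hop]
end
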